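/- arXiv:math/0305092 — 2 statements merged into one kernel-verified Lean document; each statement's English description precedes it below -/
import Mathlib

section
/- Let M, h > 0 and let {y_{jn} : j ≥ 0, 1 ≤ n ≤ M·2^{hj}} be a family of random variables on a common probability space that is jointly Gaussian and centered (every finite linear combination is a centered Gaussian random variable), with each y_{jn} having the standard normal distribution N(0,1). Let z > δ > 0. Then there exists a constant C > 0, depending only on M, h, z, δ (and not on m or on the particular jointly Gaussian family), such that for every positive integer m, setting d_j = 2^{z(j−m) − δ|j−m|}, one has P[|y_{jn}| ≤ d_j for all j ≥ 0 and all 1 ≤ n ≤ M·2^{hj}] ≥ exp(−C·2^{hm}). -/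
open MeasureTheory ProbabilityTheory Filter Set
open scoped ENNReal NNReal Topology

universe u

lemma bm_compact {K L C : Set ℝ} (hK : IsCompact K) (hL : IsCompact L) (hKn : K.Nonempty)
    (hLn : L.Nonempty) (h : ∀ x ∈ K, ∀ y ∈ L, x + y ∈ C) :
    volume K + volume L ≤ volume C := by
  obtain ⟨M, hM, hMax⟩ := hK.exists_isGreatest hKn
  obtain ⟨m, hm, hMin⟩ := hL.exists_isLeast hLn
  have e1 : volume K = volume ((fun x => x + (-m)) ⁻¹' K) :=
    (measure_preimage_add_right volume (-m) K).symm
  have e2 : volume L = volume ((fun x => x + (-M)) ⁻¹' L) :=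
    (measure_preimage_add_right volume (-M) L).symm
  rw [e1, e2, ← measure_union₀]
  · apply measure_mono
    rintro x (hx | hx)
    · have := h _ hx _ hm
      simpa using this
    · have := h _ hM _ hx
      simpa using this
  · exact (hL.measurableSet.preimage (by fun_prop)).nullMeasurableSet
  · refine measure_mono_null (t := {M + m}) ?_ (by simp)
    rintro x ⟨hx1, hx2⟩
    have a1 := hMax hx1
    have a2 := hMin hx2
    simp only [mem_singleton_iff]
    apply le_antisymm <;> linarith

lemma bm_meas {A B C : Set ℝ} (hA : MeasurableSet A) (hB : MeasurableSet B) (hAn : A.Nonempty)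
    (hBn : B.Nonempty) (h : ∀ x ∈ A, ∀ y ∈ B, x + y ∈ C) :
    volume A + volume B ≤ volume C := by
  obtain ⟨a, ha⟩ := hAn
  obtain ⟨b, hb⟩ := hBn
  rw [hA.measure_eq_iSup_isCompact, hB.measure_eq_iSup_isCompact]
  simp only [iSup_and']
  refine ENNReal.biSup_add_biSup_le' (p := fun K => K ⊆ A ∧ IsCompact K) (q := fun K => K ⊆ B ∧ IsCompact K) ⟨∅, by simp⟩ ⟨∅, by simp⟩ ?_
  rintro K ⟨hKA, hK⟩ L ⟨hLB, hL⟩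
  calc volume K + volume L ≤ volume (insert a K) + volume (insert b L) := by
        gcongr <;> exact subset_insert _ _
    _ ≤ volume C := by
      refine bm_compact (hK.insert a) (hL.insert b) (insert_nonempty _ _) (insert_nonempty _ _) ?_
      intro x hx y hy
      exact h x (insert_subset ha hKA hx) y (insert_subset hb hLB hy)

lemma bm_scaled {A B C : Set ℝ} (hA : MeasurableSet A) (hB : MeasurableSet B) (hAn : A.Nonempty)
    (hBn : B.Nonempty) {l m : ℝ} (hl : 0 < l) (hm : 0 < m)
    (h : ∀ x ∈ A, ∀ y ∈ B, l * x + m * y ∈ C) :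
    ENNReal.ofReal l * volume A + ENNReal.ofReal m * volume B ≤ volume C := by
  have key : ∀ (A : Set ℝ) (l : ℝ), 0 < l →
      ENNReal.ofReal l * volume A = volume ((fun x => l⁻¹ * x) ⁻¹' A) := by
    intro A l hl
    rw [Real.volume_preimage_mul_left (by positivity), inv_inv, abs_of_pos hl]
  rw [key A l hl, key B m hm]
  refine bm_meas (hA.preimage (by fun_prop)) (hB.preimage (by fun_prop)) ?_ ?_ ?_
  · obtain ⟨a, ha⟩ := hAn
    exact ⟨l * a, by simpa [hl.ne'] using ha⟩
  · obtain ⟨a, ha⟩ := hBn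
    exact ⟨m * a, by simpa [hm.ne'] using ha⟩
  · intro x hx y hy
    have := h _ hx _ hy
    rwa [mul_inv_cancel_left₀ hl.ne', mul_inv_cancel_left₀ hm.ne'] at this

lemma ennreal_amgm (a b : ℝ≥0∞) {l m : ℝ} (hl : 0 < l) (hm : 0 < m) (hlm : l + m = 1) :
    a ^ l * b ^ m ≤ ENNReal.ofReal l * a + ENNReal.ofReal m * b := by
  have hc : (l⁻¹).HolderConjugate m⁻¹ := by
    rw [Real.holderConjugate_iff]
    refine ⟨(one_lt_inv₀ hl).2 (by linarith), by simpa using hlm⟩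
  have := ENNReal.young_inequality (a ^ l) (b ^ m) hc
  rw [← ENNReal.rpow_mul, ← ENNReal.rpow_mul, mul_inv_cancel₀ hl.ne', mul_inv_cancel₀ hm.ne',
    ENNReal.rpow_one, ENNReal.rpow_one, ENNReal.ofReal_inv_of_pos hl,
    ENNReal.ofReal_inv_of_pos hm, ENNReal.div_eq_inv_mul, ENNReal.div_eq_inv_mul, inv_inv, inv_inv] at this
  exact this

/-- normalized one-dimensional Prekopa-Leindler -/
lemma pl_norm {f g h : ℝ → ℝ} (hf : Measurable f) (hg : Measurable g) (hh : Measurable h)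
    (hf0 : ∀ x, 0 ≤ f x) (hg0 : ∀ x, 0 ≤ g x) (hh0 : ∀ x, 0 ≤ h x)
    (hf1 : ∀ x, f x ≤ 1) (hg1 : ∀ x, g x ≤ 1)
    (hfs : ∀ s < 1, ∃ x, s < f x) (hgs : ∀ s < 1, ∃ x, s < g x)
    {l m : ℝ} (hl : 0 < l) (hm : 0 < m) (hlm : l + m = 1)
    (H : ∀ x y, f x ^ l * g y ^ m ≤ h (l * x + m * y)) :
    (∫⁻ x, ENNReal.ofReal (f x)) ^ l * (∫⁻ x, ENNReal.ofReal (g x)) ^ m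
      ≤ ∫⁻ x, ENNReal.ofReal (h x) := by
  refine (ennreal_amgm _ _ hl hm hlm).trans ?_
  rw [lintegral_eq_lintegral_meas_lt _ (ae_of_all _ hf0) hf.aemeasurable,
    lintegral_eq_lintegral_meas_lt _ (ae_of_all _ hg0) hg.aemeasurable,
    lintegral_eq_lintegral_meas_lt _ (ae_of_all _ hh0) hh.aemeasurable,
    ← lintegral_const_mul' _ _ ENNReal.ofReal_ne_top,
    ← lintegral_const_mul' _ _ ENNReal.ofReal_ne_top, ← lintegral_add_left']
  · refine setLIntegral_mono' measurableSet_Ioi fun t ht => ?_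
    rcases lt_or_ge t 1 with h1 | h1
    · refine bm_scaled (measurableSet_lt measurable_const hf) (measurableSet_lt measurable_const hg)
        (hfs t h1) (hgs t h1) hl hm ?_
      intro x hx y hy
      refine lt_of_lt_of_le ?_ (H x y)
      have ht0 : 0 < t := ht
      calc t = t ^ l * t ^ m := by rw [← Real.rpow_add ht0, hlm, Real.rpow_one]
        _ < f x ^ l * g y ^ m := by
          apply mul_lt_mul'' (Real.rpow_lt_rpow ht0.le hx hl) (Real.rpow_lt_rpow ht0.le hy hm) <;> positivity
    · have e1 : {a | t < f a} = ∅ := by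
        ext a; simpa using (hf1 a).trans h1
      have e2 : {a | t < g a} = ∅ := by
        ext a; simpa using (hg1 a).trans h1
      simp [e1, e2]
  · refine AEMeasurable.const_mul ?_ _
    refine Antitone.measurable ?_ |>.aemeasurable
    intro s t hst
    exact measure_mono fun x hx => lt_of_le_of_lt hst hx

lemma pl_one {f g h : ℝ → ℝ} (hf : Measurable f) (hg : Measurable g) (hh : Measurable h)
    (hf0 : ∀ x, 0 ≤ f x) (hg0 : ∀ x, 0 ≤ g x) (hh0 : ∀ x, 0 ≤ h x)
    {c : ℝ} (hf1 : ∀ x, f x ≤ c) (hg1 : ∀ x, g x ≤ c)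
    {l m : ℝ} (hl : 0 < l) (hm : 0 < m) (hlm : l + m = 1)
    (H : ∀ x y, f x ^ l * g y ^ m ≤ h (l * x + m * y)) :
    (∫⁻ x, ENNReal.ofReal (f x)) ^ l * (∫⁻ x, ENNReal.ofReal (g x)) ^ m
      ≤ ∫⁻ x, ENNReal.ofReal (h x) := by
  have bf : BddAbove (range f) := ⟨c, by rintro _ ⟨x, rfl⟩; exact hf1 x⟩
  have bg : BddAbove (range g) := ⟨c, by rintro _ ⟨x, rfl⟩; exact hg1 x⟩
  by_cases h0 : ∀ x, f x = 0
  · simp [h0, ENNReal.zero_rpow_of_pos hl]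
  by_cases h0' : ∀ x, g x = 0
  · simp [h0', ENNReal.zero_rpow_of_pos hm]
  push Not at h0 h0'
  obtain ⟨x0, hx0⟩ := h0
  obtain ⟨y0, hy0⟩ := h0'
  set a := ⨆ x, f x with ha
  set b := ⨆ x, g x with hb
  have ha0 : 0 < a := lt_of_lt_of_le (lt_of_le_of_ne (hf0 x0) hx0.symm) (le_ciSup bf x0)
  have hb0 : 0 < b := lt_of_lt_of_le (lt_of_le_of_ne (hg0 y0) hy0.symm) (le_ciSup bg y0)
  have key := pl_norm (f := fun x => f x / a) (g := fun x => g x / b)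
    (h := fun x => h x / (a ^ l * b ^ m)) (by fun_prop) (by fun_prop) (by fun_prop)
    (fun x => div_nonneg (hf0 x) ha0.le) (fun x => div_nonneg (hg0 x) hb0.le)
    (fun x => div_nonneg (hh0 x) (by positivity))
    (fun x => (div_le_one ha0).2 (le_ciSup bf x)) (fun x => (div_le_one hb0).2 (le_ciSup bg x))
    (fun s hs => by
      have : s * a < a := by nlinarith
      obtain ⟨x, hx⟩ := exists_lt_of_lt_ciSup this
      exact ⟨x, (lt_div_iff₀ ha0).2 hx⟩)
    (fun s hs => by
      have : s * b < b := by nlinarith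
      obtain ⟨x, hx⟩ := exists_lt_of_lt_ciSup this
      exact ⟨x, (lt_div_iff₀ hb0).2 hx⟩) hl hm hlm
    (fun x y => by
      rw [Real.div_rpow (hf0 x) ha0.le, Real.div_rpow (hg0 y) hb0.le, div_mul_div_comm]
      exact div_le_div_of_nonneg_right (H x y) (by positivity))
  have conv : ∀ (f : ℝ → ℝ) (a : ℝ), 0 < a → ∫⁻ x, ENNReal.ofReal (f x / a) =
      (ENNReal.ofReal a)⁻¹ * ∫⁻ x, ENNReal.ofReal (f x) := by
    intro f a ha
    rw [← lintegral_const_mul' _ _ (by simpa using ha)]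
    congr 1; ext x
    rw [ENNReal.ofReal_div_of_pos ha, ENNReal.div_eq_inv_mul]
  rw [conv f a ha0, conv g b hb0, conv h _ (by positivity), ENNReal.mul_rpow_of_nonneg _ _ hl.le,
    ENNReal.mul_rpow_of_nonneg _ _ hm.le, ENNReal.inv_rpow, ENNReal.inv_rpow,
    ENNReal.ofReal_rpow_of_pos ha0, ENNReal.ofReal_rpow_of_pos hb0, mul_mul_mul_comm,
    ← ENNReal.mul_inv (by simp) (by simp), ← ENNReal.ofReal_mul (by positivity)] at key
  rwa [ENNReal.mul_le_mul_iff_right (by simp) (by simp; positivity)] at key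

lemma gpdf_eq (x : ℝ) : gaussianPDFReal 0 1 x =
    (√(2 * Real.pi))⁻¹ * Real.exp (-(x ^ 2) / 2) := by
  simp [gaussianPDFReal]

lemma gpdf_le (x : ℝ) : gaussianPDFReal 0 1 x ≤ (√(2 * Real.pi))⁻¹ := by
  rw [gpdf_eq]
  refine mul_le_of_le_one_right (by positivity) ?_
  rw [Real.exp_le_one_iff]
  nlinarith [sq_nonneg x]

lemma gpdf_logconcave {l m : ℝ} (hl : 0 < l) (hm : 0 < m) (hlm : l + m = 1) (x y : ℝ) :
    gaussianPDFReal 0 1 x ^ l * gaussianPDFReal 0 1 y ^ m ≤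
      gaussianPDFReal 0 1 (l * x + m * y) := by
  simp only [gpdf_eq]
  have hc : 0 < (√(2 * Real.pi))⁻¹ := by positivity
  set c := (√(2 * Real.pi))⁻¹
  rw [Real.mul_rpow hc.le (Real.exp_pos _).le, Real.mul_rpow hc.le (Real.exp_pos _).le,
    mul_mul_mul_comm, ← Real.rpow_add hc, hlm, Real.rpow_one, ← Real.exp_mul, ← Real.exp_mul,
    ← Real.exp_add]
  gcongr
  obtain rfl : m = 1 - l := by linarith
  nlinarith [mul_nonneg (mul_nonneg hl.le hm.le) (sq_nonneg (x - y))]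

lemma pl_gauss_one {f g h : ℝ → ℝ≥0∞} (hf : Measurable f) (hg : Measurable g) (hh : Measurable h)
    (hf1 : ∀ x, f x ≤ 1) (hg1 : ∀ x, g x ≤ 1) (hh1 : ∀ x, h x ≤ 1)
    {l m : ℝ} (hl : 0 < l) (hm : 0 < m) (hlm : l + m = 1)
    (H : ∀ x y, f x ^ l * g y ^ m ≤ h (l * x + m * y)) :
    (∫⁻ x, f x ∂(gaussianReal 0 1)) ^ l * (∫⁻ x, g x ∂(gaussianReal 0 1)) ^ m
      ≤ ∫⁻ x, h x ∂(gaussianReal 0 1) := by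
  have conv : ∀ f : ℝ → ℝ≥0∞, Measurable f → (∀ x, f x ≤ 1) →
      ∫⁻ x, f x ∂(gaussianReal 0 1) =
        ∫⁻ x, ENNReal.ofReal ((f x).toReal * gaussianPDFReal 0 1 x) := by
    intro f hf hf1
    rw [gaussianReal_of_var_ne_zero _ one_ne_zero,
      lintegral_withDensity_eq_lintegral_mul _ (measurable_gaussianPDF _ _) hf]
    refine lintegral_congr fun x => ?_
    rw [ENNReal.ofReal_mul ENNReal.toReal_nonneg,
      ENNReal.ofReal_toReal (ne_top_of_le_ne_top ENNReal.one_ne_top (hf1 x)), mul_comm]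
    rfl
  have le1 : ∀ f : ℝ → ℝ≥0∞, (∀ x, f x ≤ 1) → ∀ x, (f x).toReal ≤ 1 := by
    intro f hf x
    exact ENNReal.toReal_le_of_le_ofReal zero_le_one (by simpa using hf x)
  rw [conv f hf hf1, conv g hg hg1, conv h hh hh1]
  have mp := measurable_gaussianPDFReal 0 1
  have np := gaussianPDFReal_nonneg 0 1
  refine pl_one (c := (√(2 * Real.pi))⁻¹) (by fun_prop) (by fun_prop) (by fun_prop)
    (fun x => mul_nonneg ENNReal.toReal_nonneg (np x))
    (fun x => mul_nonneg ENNReal.toReal_nonneg (np x))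
    (fun x => mul_nonneg ENNReal.toReal_nonneg (np x))
    (fun x => (mul_le_of_le_one_left (np x) (le1 f hf1 x)).trans (gpdf_le x))
    (fun x => (mul_le_of_le_one_left (np x) (le1 g hg1 x)).trans (gpdf_le x)) hl hm hlm ?_
  intro x y
  rw [Real.mul_rpow ENNReal.toReal_nonneg (np x), Real.mul_rpow ENNReal.toReal_nonneg (np y),
    mul_mul_mul_comm]
  refine mul_le_mul ?_ (gpdf_logconcave hl hm hlm x y) ?_ ENNReal.toReal_nonneg
  · rw [ENNReal.toReal_rpow, ENNReal.toReal_rpow, ← ENNReal.toReal_mul]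
    exact ENNReal.toReal_mono (ne_top_of_le_ne_top ENNReal.one_ne_top (hh1 _)) (H x y)
  · exact mul_nonneg (Real.rpow_nonneg (np x) _) (Real.rpow_nonneg (np y) _)

lemma symm_cons (n : ℕ) (p : ℝ × (Fin n → ℝ)) :
    (MeasurableEquiv.piFinSuccAbove (fun _ : Fin (n + 1) => ℝ) 0).symm p =
      (Fin.cons p.1 p.2 : Fin (n + 1) → ℝ) := by
  change Fin.insertNth (α := fun _ => ℝ) 0 p.1 p.2 = _
  rw [Fin.insertNth_zero]
  rfl

lemma lintegral_pi_succ {n : ℕ} {f : (Fin (n + 1) → ℝ) → ℝ≥0∞} (hf : Measurable f) :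
    ∫⁻ z, f z ∂(Measure.pi (fun _ : Fin (n + 1) => gaussianReal 0 1)) =
    ∫⁻ x, ∫⁻ y, f (Fin.cons x y) ∂(Measure.pi (fun _ : Fin n => gaussianReal 0 1))
      ∂(gaussianReal 0 1) := by
  have hp := (measurePreserving_piFinSuccAbove (fun _ : Fin (n + 1) => gaussianReal 0 1) 0).symm
  rw [← hp.lintegral_comp hf, lintegral_prod]
  · simp only [symm_cons]
  · exact (hf.comp (MeasurableEquiv.measurable _)).aemeasurable

lemma measurable_cons (n : ℕ) :
    Measurable (fun p : ℝ × (Fin n → ℝ) => (Fin.cons p.1 p.2 : Fin (n + 1) → ℝ)) := by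
  have h := (MeasurableEquiv.piFinSuccAbove (fun _ : Fin (n + 1) => ℝ) 0).symm.measurable
  rwa [show ⇑(MeasurableEquiv.piFinSuccAbove (fun _ : Fin (n + 1) => ℝ) 0).symm = _ from
    funext (symm_cons n)] at h

lemma pl_gauss (n : ℕ) {f g h : (Fin n → ℝ) → ℝ≥0∞}
    (hf : Measurable f) (hg : Measurable g) (hh : Measurable h)
    (hf1 : ∀ x, f x ≤ 1) (hg1 : ∀ x, g x ≤ 1) (hh1 : ∀ x, h x ≤ 1)
    {l m : ℝ} (hl : 0 < l) (hm : 0 < m) (hlm : l + m = 1)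
    (H : ∀ x y, f x ^ l * g y ^ m ≤ h (l • x + m • y)) :
    (∫⁻ x, f x ∂(Measure.pi (fun _ : Fin n => gaussianReal 0 1))) ^ l *
      (∫⁻ x, g x ∂(Measure.pi (fun _ : Fin n => gaussianReal 0 1))) ^ m
      ≤ ∫⁻ x, h x ∂(Measure.pi (fun _ : Fin n => gaussianReal 0 1)) := by
  induction n with
  | zero =>
    rw [Measure.pi_of_empty _ 0, lintegral_dirac, lintegral_dirac, lintegral_dirac]
    simpa using H 0 0
  | succ n ih =>
    rw [lintegral_pi_succ hf, lintegral_pi_succ hg, lintegral_pi_succ hh]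
    have hb : ∀ f : (Fin (n + 1) → ℝ) → ℝ≥0∞, (∀ x, f x ≤ 1) → ∀ x,
        ∫⁻ y, f (Fin.cons x y) ∂(Measure.pi (fun _ : Fin n => gaussianReal 0 1)) ≤ 1 := by
      intro f hf x
      refine (lintegral_mono (fun y => hf _)).trans ?_
      simp
    refine pl_gauss_one (hf.comp (measurable_cons n)).lintegral_prod_right'
      (hg.comp (measurable_cons n)).lintegral_prod_right'
      (hh.comp (measurable_cons n)).lintegral_prod_right' (hb f hf1) (hb g hg1) (hb h hh1)
      hl hm hlm ?_
    intro x y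
    have hs : ∀ x : ℝ, Measurable (fun v : Fin n → ℝ => (Fin.cons x v : Fin (n + 1) → ℝ)) :=
      fun x => (measurable_cons n).comp measurable_prodMk_left
    refine ih (hf.comp (hs x)) (hg.comp (hs y)) (hh.comp (hs _)) (fun _ => hf1 _) (fun _ => hg1 _)
      (fun _ => hh1 _) ?_
    intro u v
    have := H (Fin.cons x u) (Fin.cons y v)
    refine this.trans_eq (congrArg h ?_)
    ext i
    refine Fin.cases ?_ (fun j => ?_) i <;> simp

open scoped MatrixOrder in
lemma gauss_rep {ι : Type*} [Fintype ι] [DecidableEq ι] (ν : Measure (EuclideanSpace ℝ ι))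
    [IsGaussian ν] (h0 : ∫ x, x ∂ν = 0) :
    ∃ (n : ℕ) (L : (Fin n → ℝ) →L[ℝ] EuclideanSpace ℝ ι),
      ν = (Measure.pi (fun _ : Fin n => gaussianReal 0 1)).map L := by
  let b := EuclideanSpace.basisFun ι ℝ
  let S : Matrix ι ι ℝ := Matrix.of fun i j => covarianceBilin ν (b i) (b j)
  have hquad : ∀ x y : EuclideanSpace ℝ ι, covarianceBilin ν x y = x ⬝ᵥ S.mulVec y := by
    intro x y
    conv_lhs => rw [← b.sum_repr x, ← b.sum_repr y]
    simp [S, dotProduct, Matrix.mulVec, Finset.mul_sum, b, mul_comm, mul_left_comm]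
    try rw [Finset.sum_comm]
  have hS : S.PosSemidef := by
    refine Matrix.PosSemidef.of_dotProduct_mulVec_nonneg ?_ ?_
    · ext i j
      simp only [S, Matrix.conjTranspose_apply, Matrix.of_apply, star_trivial]
      exact isPosSemidef_covarianceBilin.isSymm.eq (b j) (b i)
    · intro x
      have := isPosSemidef_covarianceBilin (μ := ν).nonneg (WithLp.toLp 2 x)
      have e := hquad (WithLp.toLp 2 x) (WithLp.toLp 2 x)
      simp only [star_trivial]
      rw [← e]
      exact this
  have e : ν = multivariateGaussian 0 S := by
    apply IsGaussian.ext
    · simp [h0]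
    · ext x y
      rw [covarianceBilin_multivariateGaussian hS, hquad]
  let A : EuclideanSpace ℝ ι →L[ℝ] EuclideanSpace ℝ ι :=
    Matrix.toEuclideanCLM (𝕜 := ℝ) (CFC.sqrt S)
  let d := Module.finrank ℝ (EuclideanSpace ℝ ι)
  let B : (Fin d → ℝ) →L[ℝ] EuclideanSpace ℝ ι :=
    ∑ i, (ContinuousLinearMap.proj i).smulRight (stdOrthonormalBasis ℝ (EuclideanSpace ℝ ι) i)
  refine ⟨d, A.comp B, ?_⟩
  rw [e, multivariateGaussian, stdGaussian, Measure.map_map (by fun_prop) (by fun_prop)]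
  congr 1
  ext x
  simp [A, B, d]

instance neg_inv_gauss : (gaussianReal 0 1).IsNegInvariant :=
  ⟨by
    have := gaussianReal_map_neg (μ := 0) (v := 1)
    rw [neg_zero] at this
    exact this⟩

lemma gauss_unimodal {ι : Type*} [Fintype ι] [DecidableEq ι] (ν : Measure (EuclideanSpace ℝ ι))
    [IsGaussian ν] (h0 : ∫ x, x ∂ν = 0) (I : Finset ι) (b r : ι → ℝ) {s t : ℝ} (hst : |s| ≤ |t|) :
    ν {x | ∀ i ∈ I, |x i + t * b i| ≤ r i} ≤ ν {x | ∀ i ∈ I, |x i + s * b i| ≤ r i} := by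
  obtain ⟨n, L, hL⟩ := gauss_rep ν h0
  have hmeas : ∀ t : ℝ, MeasurableSet {x : EuclideanSpace ℝ ι | ∀ i ∈ I, |x i + t * b i| ≤ r i} := by
    intro t
    simp only [Set.ofPred_forall]
    refine Finset.measurableSet_biInter _ fun i _ => ?_
    exact measurableSet_le (by fun_prop) measurable_const
  rw [hL, Measure.map_apply (by fun_prop) (hmeas _), Measure.map_apply (by fun_prop) (hmeas _)]
  have hmeas' : ∀ t : ℝ, MeasurableSet {z : Fin n → ℝ | ∀ i ∈ I, |L z i + t * b i| ≤ r i} :=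
    fun t => (hmeas t).preimage L.continuous.measurable
  simp only [Set.preimage_ofPred_eq]
  set μ := Measure.pi (fun _ : Fin n => gaussianReal 0 1)
  set G : ℝ → ℝ≥0∞ := fun t => μ {z : Fin n → ℝ | ∀ i ∈ I, |L z i + t * b i| ≤ r i} with hG
  have even : ∀ t, G (-t) = G t := by
    intro t
    rw [hG]
    simp only
    rw [← Measure.measure_neg μ]
    congr 1
    ext z
    simp only [Set.mem_neg, Set.mem_ofPred_eq, map_neg, PiLp.neg_apply]
    refine forall₂_congr fun i _ => ?_
    rw [← abs_neg]
    ring_nf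
  change G t ≤ G s
  rcases hst.eq_or_lt with heq | hlt
  · rcases abs_eq_abs.1 heq with h | h
    · rw [h]
    · rw [h, even]
  have ht0 : t ≠ 0 := by
    rintro rfl
    simp at hlt
    exact absurd hlt (not_lt.2 (abs_nonneg s))
  have hq : |s / t| < 1 := by
    rw [abs_div]
    exact (div_lt_one (abs_pos.2 ht0)).2 hlt
  rw [abs_lt] at hq
  set l := (1 + s / t) / 2 with hl
  set m := (1 - s / t) / 2 with hm
  have hl0 : 0 < l := by rw [hl]; linarith
  have hm0 : 0 < m := by rw [hm]; linarith
  have hlm : l + m = 1 := by rw [hl, hm]; ring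
  have hs : s = l * t + m * (-t) := by rw [hl, hm]; field_simp; ring
  have key := pl_gauss n
    (f := {z : Fin n → ℝ | ∀ i ∈ I, |L z i + t * b i| ≤ r i}.indicator 1)
    (g := {z : Fin n → ℝ | ∀ i ∈ I, |L z i + (-t) * b i| ≤ r i}.indicator 1)
    (h := {z : Fin n → ℝ | ∀ i ∈ I, |L z i + s * b i| ≤ r i}.indicator 1)
    (measurable_one.indicator (hmeas' _)) (measurable_one.indicator (hmeas' _))
    (measurable_one.indicator (hmeas' _))
    (fun x => indicator_le_self' (by simp) x) (fun x => indicator_le_self' (by simp) x)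
    (fun x => indicator_le_self' (by simp) x) hl0 hm0 hlm (by
      intro x y
      by_cases hx : x ∈ {z : Fin n → ℝ | ∀ i ∈ I, |L z i + t * b i| ≤ r i}
      swap
      · rw [indicator_of_notMem hx, ENNReal.zero_rpow_of_pos hl0, zero_mul]; exact zero_le
      by_cases hy : y ∈ {z : Fin n → ℝ | ∀ i ∈ I, |L z i + (-t) * b i| ≤ r i}
      swap
      · rw [indicator_of_notMem hy, ENNReal.zero_rpow_of_pos hm0, mul_zero]; exact zero_le
      have hxy : l • x + m • y ∈ {z : Fin n → ℝ | ∀ i ∈ I, |L z i + s * b i| ≤ r i} := by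
        intro i hi
        have h1 := abs_le.1 (hx i hi)
        have h2 := abs_le.1 (hy i hi)
        simp only [map_add, map_smul, PiLp.add_apply, PiLp.smul_apply, smul_eq_mul]
        have e : l * L x i + m * L y i + s * b i =
          l * (L x i + t * b i) + m * (L y i + (-t) * b i) := by rw [hs]; ring
        have hr : l * r i + m * r i = r i := by rw [← add_mul, hlm, one_mul]
        rw [e, abs_le]
        constructor <;> nlinarith [mul_le_mul_of_nonneg_left h1.1 hl0.le, mul_le_mul_of_nonneg_left h1.2 hl0.le, mul_le_mul_of_nonneg_left h2.1 hm0.le, mul_le_mul_of_nonneg_left h2.2 hm0.le]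
      rw [indicator_of_mem hx, indicator_of_mem hy, indicator_of_mem hxy]
      simp)
  rw [lintegral_indicator_one (hmeas' _), lintegral_indicator_one (hmeas' _),
    lintegral_indicator_one (hmeas' _)] at key
  change G t ^ l * G (-t) ^ m ≤ G s at key
  rw [even, ← ENNReal.rpow_add_of_nonneg _ _ hl0.le hm0.le, hlm, ENNReal.rpow_one] at key
  exact key

lemma chebyshev_assoc (γ : Measure ℝ) [IsProbabilityMeasure γ] {F : ℝ → ℝ≥0∞}
    {r : ℝ} (hr : 0 < r) (hF : ∀ s t, |s| ≤ |t| → F t ≤ F s) :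
    γ (Icc (-r) r) * ∫⁻ t, F t ∂γ ≤ ∫⁻ t in Icc (-r) r, F t ∂γ := by
  set A := Icc (-r) r
  have hA : MeasurableSet A := measurableSet_Icc
  have h1 : F r * γ A ≤ ∫⁻ t in A, F t ∂γ := by
    rw [← setLIntegral_const]
    refine setLIntegral_mono' hA fun t ht => hF _ _ ?_
    rw [abs_of_pos hr]; exact abs_le.2 ht
  have h2 : ∫⁻ t in Aᶜ, F t ∂γ ≤ F r * γ Aᶜ := by
    rw [← setLIntegral_const]
    refine setLIntegral_mono' hA.compl fun t ht => hF _ _ ?_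
    rw [abs_of_pos hr]
    by_contra h
    exact ht (abs_le.1 (not_le.1 h).le)
  calc γ A * ∫⁻ t, F t ∂γ = γ A * (∫⁻ t in A, F t ∂γ) + γ A * ∫⁻ t in Aᶜ, F t ∂γ := by
        rw [← mul_add, lintegral_add_compl _ hA]
    _ ≤ γ A * (∫⁻ t in A, F t ∂γ) + γ A * (F r * γ Aᶜ) := by gcongr
    _ = γ A * (∫⁻ t in A, F t ∂γ) + (F r * γ A) * γ Aᶜ := by ring
    _ ≤ γ A * (∫⁻ t in A, F t ∂γ) + (∫⁻ t in A, F t ∂γ) * γ Aᶜ := by gcongr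
    _ = (γ A + γ Aᶜ) * ∫⁻ t in A, F t ∂γ := by ring
    _ = ∫⁻ t in A, F t ∂γ := by
        rw [measure_add_measure_compl hA, measure_univ, one_mul]

lemma sidak_step {Ω ι : Type*} [MeasurableSpace Ω] {P : Measure Ω} [IsProbabilityMeasure P]
    [Fintype ι] [DecidableEq ι] {X : ι → Ω → ℝ} (hX : HasGaussianLaw (fun ω i => X i ω) P)
    (hm : ∀ i, Measurable (X i)) (h1 : ∀ i, P.map (X i) = gaussianReal 0 1)
    {r : ι → ℝ} (hr : ∀ i, 0 < r i) (i0 : ι) (I : Finset ι) :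
    gaussianReal 0 1 (Icc (-r i0) (r i0)) * P {ω | ∀ i ∈ I, |X i ω| ≤ r i} ≤
      P {ω | |X i0 ω| ≤ r i0 ∧ ∀ i ∈ I, |X i ω| ≤ r i} := by
  set c : ι → ℝ := fun i => cov[X i, X i0; P] with hc
  set Y : ι → Ω → ℝ := fun i ω => X i ω - c i * X i0 ω with hY
  have hmean : ∀ i, ∫ ω, X i ω ∂P = 0 := by
    intro i
    have := integral_map (hm i).aemeasurable (f := fun x : ℝ => x) (μ := P) (by fun_prop)
    rw [← this, h1, integral_id_gaussianReal]
  have hL2 : ∀ i, MemLp (X i) 2 P := fun i => (hX.eval i).memLp_two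
  have hmY : ∀ i, Measurable (Y i) := fun i => (hm i).sub ((hm i0).const_mul _)
  have hvar : cov[X i0, X i0; P] = 1 := by
    rw [covariance_self (hm i0).aemeasurable]
    have := variance_map (μ := P) (X := fun x : ℝ => x) (Y := X i0) (by fun_prop) (hm i0).aemeasurable
    rw [h1, variance_fun_id_gaussianReal] at this
    simpa [Function.comp_def] using this.symm
  -- joint law
  let Lp : (ι → ℝ) →L[ℝ] (Unit → ℝ) × (ι → ℝ) :=
    (ContinuousLinearMap.pi fun _ => ContinuousLinearMap.proj i0).prod
      (ContinuousLinearMap.pi fun i => ContinuousLinearMap.proj i - c i • ContinuousLinearMap.proj i0)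
  have hjoint : HasGaussianLaw (fun ω => (fun _ : Unit => X i0 ω, fun i => Y i ω)) P :=
    hX.map_fun Lp
  have hind0 := HasGaussianLaw.indepFun_of_covariance_eval (X := fun _ : Unit => X i0) (Y := Y) hjoint
    (by
      intro _ i
      rw [hY]
      simp only
      rw [covariance_fun_sub_right (hL2 i0) (hL2 i) ((hL2 i0).const_mul _),
        covariance_const_mul_right, hvar, covariance_comm, mul_one, hc, sub_self])
  let Z : Ω → EuclideanSpace ℝ ι := fun ω => WithLp.toLp 2 (fun i => Y i ω)
  have hmZ : Measurable Z := by
    exact (WithLp.measurable_toLp 2 _).comp (measurable_pi_lambda _ hmY)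
  have hind : IndepFun (X i0) Z P :=
    hind0.comp (φ := fun v : Unit → ℝ => v ()) (ψ := WithLp.toLp 2)
      (measurable_pi_apply _) (WithLp.measurable_toLp 2 _)
  have hZ : HasGaussianLaw Z P := HasGaussianLaw.toLp_pi 2 hjoint.snd
  set ν := P.map Z with hν
  have : IsGaussian ν := hZ.isGaussian_map
  have hν0 : ∫ x, x ∂ν = 0 := by
    rw [hν, integral_map hmZ.aemeasurable (by fun_prop)]
    ext i
    have e := ContinuousLinearMap.integral_comp_comm (EuclideanSpace.proj i : EuclideanSpace ℝ ι →L[ℝ] ℝ) hZ.integrable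
    change ∫ ω, Z ω i ∂P = (∫ ω, Z ω ∂P) i at e
    rw [← e]
    simp only [Z, hY, PiLp.zero_apply]
    rw [integral_sub (hX.eval i).integrable ((hX.eval i0).integrable.const_mul _), hmean,
      integral_const_mul, hmean]
    simp
  have hprod := (indepFun_iff_map_prod_eq_prod_map_map (hm i0).aemeasurable hmZ.aemeasurable).1 hind
  rw [h1] at hprod
  set K : ℝ → Set (EuclideanSpace ℝ ι) := fun t => {x | ∀ i ∈ I, |x i + t * c i| ≤ r i} with hK
  set Q : Set (ℝ × EuclideanSpace ℝ ι) := {p | ∀ i ∈ I, |p.2 i + p.1 * c i| ≤ r i} with hQ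
  have hQm : MeasurableSet Q := by
    rw [hQ]
    simp only [Set.ofPred_forall]
    refine Finset.measurableSet_biInter _ fun i _ => ?_
    exact measurableSet_le (by fun_prop) measurable_const
  have hpm : Measurable fun ω => (X i0 ω, Z ω) := (hm i0).prodMk hmZ
  have hZX : ∀ ω i, Z ω i + X i0 ω * c i = X i ω := by
    intro ω i; simp only [Z, hY]; ring
  have e1 : P {ω | ∀ i ∈ I, |X i ω| ≤ r i} = ∫⁻ t, ν (K t) ∂(gaussianReal 0 1) := by
    have : {ω | ∀ i ∈ I, |X i ω| ≤ r i} = (fun ω => (X i0 ω, Z ω)) ⁻¹' Q := by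
      ext ω
      simp only [hQ, Set.preimage_ofPred_eq, Set.mem_ofPred_eq, hZX]
    rw [this, ← Measure.map_apply hpm hQm, hprod, Measure.prod_apply hQm]
    rfl
  have hAm : MeasurableSet (Icc (-r i0) (r i0)) := measurableSet_Icc
  have e2 : P {ω | |X i0 ω| ≤ r i0 ∧ ∀ i ∈ I, |X i ω| ≤ r i} =
      ∫⁻ t in Icc (-r i0) (r i0), ν (K t) ∂(gaussianReal 0 1) := by
    have : {ω | |X i0 ω| ≤ r i0 ∧ ∀ i ∈ I, |X i ω| ≤ r i} =
        (fun ω => (X i0 ω, Z ω)) ⁻¹' (Q ∩ Icc (-r i0) (r i0) ×ˢ univ) := by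
      ext ω
      simp only [hQ, Set.mem_preimage, Set.mem_inter_iff, Set.mem_ofPred_eq, hZX, Set.mem_prod,
        Set.mem_univ, and_true, mem_Icc, abs_le]
      tauto
    rw [this, ← Measure.map_apply hpm (hQm.inter (hAm.prod MeasurableSet.univ)), hprod,
      ← Measure.restrict_apply hQm, ← Measure.prod_restrict, Measure.restrict_univ,
      Measure.prod_apply hQm]
    rfl
  rw [e1, e2]
  exact chebyshev_assoc _ (hr i0) fun s t hst => gauss_unimodal ν hν0 I c r hst

lemma sidak {Ω ι : Type*} [MeasurableSpace Ω] {P : Measure Ω} [IsProbabilityMeasure P]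
    [Fintype ι] [DecidableEq ι] {X : ι → Ω → ℝ} (hX : HasGaussianLaw (fun ω i => X i ω) P)
    (hm : ∀ i, Measurable (X i)) (h1 : ∀ i, P.map (X i) = gaussianReal 0 1)
    {r : ι → ℝ} (hr : ∀ i, 0 < r i) (I : Finset ι) :
    ∏ i ∈ I, gaussianReal 0 1 (Icc (-r i) (r i)) ≤ P {ω | ∀ i ∈ I, |X i ω| ≤ r i} := by
  induction I using Finset.induction_on with
  | empty => simp
  | insert a s ha ih =>
    rw [Finset.prod_insert ha]
    refine (mul_le_mul_right ih _).trans ((sidak_step hX hm h1 hr a s).trans_eq ?_)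
    congr 1
    ext ω
    simp

lemma gauss_small : ∃ κ : ℝ, 0 < κ ∧ ∀ d : ℝ, 0 < d → d ≤ 1 →
    ENNReal.ofReal (κ * d) ≤ gaussianReal 0 1 (Icc (-d) d) := by
  refine ⟨2 * gaussianPDFReal 0 1 1, mul_pos two_pos (gaussianPDFReal_pos _ _ _ one_ne_zero), ?_⟩
  intro d hd hd1
  rw [gaussianReal_apply _ one_ne_zero]
  calc ENNReal.ofReal (2 * gaussianPDFReal 0 1 1 * d)
      = ∫⁻ _ in Icc (-d) d, ENNReal.ofReal (gaussianPDFReal 0 1 1) := by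
        rw [setLIntegral_const, Real.volume_Icc, ← ENNReal.ofReal_mul (gaussianPDFReal_nonneg _ _ _)]
        congr 1; ring
    _ ≤ _ := by
        refine setLIntegral_mono' measurableSet_Icc fun x hx => ?_
        rw [gaussianPDF]
        refine ENNReal.ofReal_le_ofReal ?_
        rw [gpdf_eq, gpdf_eq]
        refine mul_le_mul_of_nonneg_left (Real.exp_le_exp.2 ?_) (by positivity)
        have h1 : -1 ≤ x := by linarith [hx.1]
        have h2 : x ≤ 1 := by linarith [hx.2]
        nlinarith

lemma gauss_tail {p : ℝ} (hp : 0 < p) : ∃ K : ℝ, 0 ≤ K ∧ ∀ d : ℝ, 0 < d →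
    gaussianReal 0 1 (Icc (-d) d)ᶜ ≤ ENNReal.ofReal (K * d ^ (-p)) := by
  have hmem := memLp_id_gaussianReal' (μ := 0) (v := 1) (ENNReal.ofReal p) ENNReal.ofReal_ne_top
  have hfin : ∫⁻ x, ‖x‖ₑ ^ p ∂(gaussianReal 0 1) < ∞ := by
    have := lintegral_rpow_enorm_lt_top_of_eLpNorm_lt_top (p := ENNReal.ofReal p)
      (by simpa using hp) ENNReal.ofReal_ne_top hmem.2
    simpa [ENNReal.toReal_ofReal hp.le] using this
  refine ⟨(∫⁻ x, ‖x‖ₑ ^ p ∂(gaussianReal 0 1)).toReal, ENNReal.toReal_nonneg, fun d hd => ?_⟩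
  have hmk := mul_meas_ge_le_lintegral₀ (μ := gaussianReal 0 1) (f := fun x : ℝ => ‖x‖ₑ ^ p)
    (by fun_prop) (ENNReal.ofReal (d ^ p))
  have hsub : (Icc (-d) d)ᶜ ⊆ {x : ℝ | ENNReal.ofReal (d ^ p) ≤ ‖x‖ₑ ^ p} := by
    intro x hx
    have hx' : d ≤ |x| := by
      by_contra h
      exact hx (abs_le.1 (not_le.1 h).le)
    simp only [Set.mem_ofPred_eq]
    rw [← ENNReal.ofReal_rpow_of_pos hd]
    gcongr
    rw [Real.enorm_eq_ofReal_abs]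
    exact ENNReal.ofReal_le_ofReal hx'
  have hdp : 0 < d ^ p := Real.rpow_pos_of_pos hd p
  refine (measure_mono hsub).trans ?_
  rw [ENNReal.ofReal_mul ENNReal.toReal_nonneg, ENNReal.ofReal_toReal hfin.ne, Real.rpow_neg hd.le,
    ENNReal.ofReal_inv_of_pos hdp, ← div_eq_mul_inv, ENNReal.le_div_iff_mul_le (by simp [hdp]) (by simp),
    mul_comm]
  exact hmk

lemma gauss_lower {p : ℝ} (hp : 0 < p) : ∃ c : ℝ, 0 < c ∧ ∀ d : ℝ, 0 < d →
    ENNReal.ofReal (Real.exp (-(c * d ^ (-p)))) ≤ gaussianReal 0 1 (Icc (-d) d) := by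
  obtain ⟨κ, hκ, hsmall⟩ := gauss_small
  obtain ⟨K, hK, htail⟩ := gauss_tail hp
  refine ⟨|Real.log κ| + 1 / p + K / κ, by positivity, fun d hd => ?_⟩
  have hdp : 0 < d ^ (-p) := Real.rpow_pos_of_pos hd _
  rcases le_or_gt d 1 with h1 | h1
  · refine le_trans (ENNReal.ofReal_le_ofReal ?_) (hsmall d hd h1)
    rw [← Real.le_log_iff_exp_le (by positivity), Real.log_mul hκ.ne' hd.ne']
    have a1 : 1 ≤ d ^ (-p) := Real.one_le_rpow_of_pos_of_le_one_of_nonpos hd h1 (by linarith)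
    have a2 : Real.log d⁻¹ ≤ d ^ (-p) / p := by
      have := Real.log_le_rpow_div (x := d⁻¹) (by positivity) hp
      rwa [Real.inv_rpow hd.le, ← Real.rpow_neg hd.le] at this
    rw [Real.log_inv] at a2
    have a3 := neg_abs_le (Real.log κ)
    have a4 : |Real.log κ| ≤ |Real.log κ| * d ^ (-p) := le_mul_of_one_le_right (abs_nonneg _) a1
    have a5 : 0 ≤ K / κ * d ^ (-p) := by positivity
    have a6 : 1 / p * d ^ (-p) = d ^ (-p) / p := by ring
    nlinarith
  · set q := (gaussianReal 0 1).real (Icc (-d) d) with hq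
    have hqκ : κ ≤ q := by
      have h2 := (hsmall 1 one_pos le_rfl).trans
        (measure_mono (Icc_subset_Icc (neg_le_neg h1.le) h1.le))
      rw [mul_one] at h2
      exact (ENNReal.ofReal_le_iff_le_toReal (measure_ne_top _ _)).1 h2
    have hq0 : 0 < q := hκ.trans_le hqκ
    have ht : 1 - q ≤ K * d ^ (-p) := by
      have := ENNReal.toReal_le_of_le_ofReal (by positivity) (htail d hd)
      change (gaussianReal 0 1).real _ ≤ _ at this
      rwa [probReal_compl_eq_one_sub measurableSet_Icc] at this
    rw [ENNReal.ofReal_le_iff_le_toReal (measure_ne_top _ _)]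
    change _ ≤ q
    rw [← Real.le_log_iff_exp_le hq0]
    have b1 := Real.one_sub_inv_le_log_of_pos hq0
    have b2 : 1 - q⁻¹ = -((1 - q) / q) := by field_simp; ring
    have b3 : (1 - q) / q ≤ K * d ^ (-p) / κ := by
      exact div_le_div₀ (by positivity) ht hκ hqκ
    have b4 : 0 ≤ (|Real.log κ| + 1 / p) * d ^ (-p) := by positivity
    have b5 : K / κ * d ^ (-p) = K * d ^ (-p) / κ := by ring
    rw [add_mul]
    linarith

lemma two_sided_sum {ρ : ℝ} (h0 : 0 < ρ) (h1 : ρ < 1) :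
    ∃ D : ℝ, 0 ≤ D ∧ ∀ N m : ℕ, ∑ j ∈ Finset.range N, ρ ^ |(j : ℝ) - m| ≤ D := by
  have hs : Summable (fun k : ℤ => ρ ^ |(k : ℝ)|) := by
    have hg : Summable (fun n : ℕ => ρ ^ |(n : ℝ)|) := by
      simpa using summable_geometric_of_lt_one h0.le h1
    refine Summable.of_nat_of_neg ?_ ?_
    · simpa using hg
    · simpa using hg
  refine ⟨∑' k : ℤ, ρ ^ |(k : ℝ)|, tsum_nonneg fun k => by positivity, fun N m => ?_⟩
  have hinj : Function.Injective (fun j : ℕ => (j : ℤ) - m) := by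
    intro a b hab
    simpa using hab
  calc ∑ j ∈ Finset.range N, ρ ^ |(j : ℝ) - m|
      = ∑ k ∈ (Finset.range N).image (fun j : ℕ => (j : ℤ) - m), ρ ^ |(k : ℝ)| := by
        rw [Finset.sum_image (fun a _ b _ hab => hinj hab)]
        simp
    _ ≤ _ := hs.sum_le_tsum _ (fun k _ => by positivity)

lemma level_bound {h z δ : ℝ} (hh : 0 < h) (hδ : 0 < δ) (hzδ : δ < z) :
    ∃ c : ℝ, 0 < c ∧ ∀ x : ℝ,
      ENNReal.ofReal (Real.exp (-(c * (2 ^ (-(h * x)) * ((2 : ℝ) ^ (-(h / 2))) ^ |x|)))) ≤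
        gaussianReal 0 1 (Icc (-(2 ^ (z * x - δ * |x|))) (2 ^ (z * x - δ * |x|))) := by
  obtain ⟨c1, hc1, H1⟩ := gauss_lower (p := (3 * h / 2) / (z - δ))
    (div_pos (by positivity) (by linarith))
  obtain ⟨c2, hc2, H2⟩ := gauss_lower (p := (h / 2) / (z + δ))
    (div_pos (by positivity) (by linarith))
  refine ⟨c1 + c2, by positivity, fun x => ?_⟩
  have hd : (0 : ℝ) < 2 ^ (z * x - δ * |x|) := by positivity
  have hz1 : z - δ ≠ 0 := by linarith
  have hz2 : z + δ ≠ 0 := by linarith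
  have hw : (2 : ℝ) ^ (-(h * x)) * ((2 : ℝ) ^ (-(h / 2))) ^ |x| =
      2 ^ (-(h * x) + -(h / 2) * |x|) := by
    rw [← Real.rpow_mul two_pos.le, ← Real.rpow_add two_pos]
  have hpos : (0 : ℝ) < 2 ^ (-(h * x) + -(h / 2) * |x|) := by positivity
  rw [hw]
  rcases le_total 0 x with hx | hx
  · refine le_trans (ENNReal.ofReal_le_ofReal (Real.exp_le_exp.2 ?_)) (H1 _ hd)
    rw [← Real.rpow_mul two_pos.le]
    have e : (z * x - δ * |x|) * -(3 * h / 2 / (z - δ)) = -(h * x) + -(h / 2) * |x| := by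
      rw [abs_of_nonneg hx]; field_simp; ring
    rw [e]
    nlinarith
  · refine le_trans (ENNReal.ofReal_le_ofReal (Real.exp_le_exp.2 ?_)) (H2 _ hd)
    rw [← Real.rpow_mul two_pos.le]
    have e : (z * x - δ * |x|) * -(h / 2 / (z + δ)) = -(h * x) + -(h / 2) * |x| := by
      rw [abs_of_nonpos hx]; field_simp; ring
    rw [e]
    nlinarith

/-- The Gaussian (α = 2) decorrelation lemma: for every jointly Gaussian, centered array
`{y_{jn} : j ≥ 0, 1 ≤ n ≤ M 2^{hj}}` of standard normal random variables and every
positive integer `m`, with `d_j = 2^{z(j-m) - δ|j-m|}` (`0 < δ < z`),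
`P[∀ j n, |y_{jn}| ≤ d_j] ≥ exp(-C 2^{hm})`, where `C` depends only on `M, h, z, δ`. -/
theorem gaussian_array_decorrelation (M h z δ : ℝ)
    (hM : 0 < M) (hh : 0 < h) (hδ : 0 < δ) (hzδ : δ < z) :
    ∃ C : ℝ, 0 < C ∧
      ∀ (Ω : Type u) (_ : MeasurableSpace Ω) (P : Measure Ω), IsProbabilityMeasure P →
        ∀ y : ℕ → ℕ → Ω → ℝ,
          (∀ j n : ℕ, 1 ≤ n → (n : ℝ) ≤ M * 2 ^ (h * j) → Measurable (y j n)) →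
          (∀ (s : Finset (ℕ × ℕ)) (c : ℕ × ℕ → ℝ),
            (∀ q ∈ s, 1 ≤ q.2 ∧ (q.2 : ℝ) ≤ M * 2 ^ (h * q.1)) →
            ∃ v : ℝ≥0, P.map (fun ω => ∑ q ∈ s, c q * y q.1 q.2 ω) = gaussianReal 0 v) →
          (∀ j n : ℕ, 1 ≤ n → (n : ℝ) ≤ M * 2 ^ (h * j) →
            P.map (y j n) = gaussianReal 0 1) →
          ∀ m : ℕ, 0 < m →
            ENNReal.ofReal (Real.exp (-C * 2 ^ (h * m))) ≤
              P {ω | ∀ j n : ℕ, 1 ≤ n → (n : ℝ) ≤ M * 2 ^ (h * j) →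
                  |y j n ω| ≤ 2 ^ (z * ((j : ℝ) - m) - δ * |(j : ℝ) - m|)} := by
  classical
  obtain ⟨c, hc, hlev⟩ := level_bound hh hδ hzδ
  obtain ⟨D, hD, hsum⟩ := two_sided_sum (ρ := (2 : ℝ) ^ (-(h / 2))) (by positivity)
    (Real.rpow_lt_one_of_one_lt_of_neg one_lt_two (by linarith))
  refine ⟨M * c * D + 1, by positivity, ?_⟩
  intro Ω _ P hP y hmeas hgauss hstd m hm0
  set d : ℕ → ℝ := fun j => 2 ^ (z * ((j : ℝ) - m) - δ * |(j : ℝ) - m|) with hd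
  have hdpos : ∀ j, 0 < d j := fun j => by simp only [hd]; positivity
  set s : ℕ → Finset (ℕ × ℕ) := fun N => (Finset.range N ×ˢ Finset.range N).filter
    (fun q => 1 ≤ q.2 ∧ (q.2 : ℝ) ≤ M * 2 ^ (h * q.1)) with hs
  have hsmem : ∀ N, ∀ q ∈ s N, 1 ≤ q.2 ∧ (q.2 : ℝ) ≤ M * 2 ^ (h * q.1) := by
    intro N q hq
    exact (Finset.mem_filter.1 hq).2
  set E : ℕ → Set Ω := fun N => {ω | ∀ q ∈ s N, |y q.1 q.2 ω| ≤ d q.1} with hE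
  have hEm : ∀ N, MeasurableSet (E N) := by
    intro N
    simp only [hE, Set.ofPred_forall]
    refine Finset.measurableSet_biInter _ fun q hq => ?_
    exact measurableSet_le (hmeas _ _ (hsmem N q hq).1 (hsmem N q hq).2).abs measurable_const
  have hEanti : Antitone E := by
    intro N N' hNN ω hω q hq
    refine hω q ?_
    simp only [hs, Finset.mem_filter, Finset.mem_product, Finset.mem_range] at hq ⊢
    exact ⟨⟨by omega, by omega⟩, hq.2⟩
  have hEi : {ω | ∀ j n : ℕ, 1 ≤ n → (n : ℝ) ≤ M * 2 ^ (h * j) → |y j n ω| ≤ d j} = ⋂ N, E N := by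
    ext ω
    simp only [Set.mem_ofPred_eq, mem_iInter]
    constructor
    · intro H N q hq
      exact H _ _ (hsmem N q hq).1 (hsmem N q hq).2
    · intro H j n h1 h2
      refine H (max j n + 1) (j, n) ?_
      simp only [hs, Finset.mem_filter, Finset.mem_product, Finset.mem_range]
      exact ⟨⟨by omega, by omega⟩, h1, h2⟩
  rw [hEi]
  refine ge_of_tendsto' (tendsto_measure_iInter_atTop (fun N => (hEm N).nullMeasurableSet) hEanti
    ⟨0, measure_ne_top _ _⟩) fun N => ?_
  simp only [Function.comp_apply]
  -- apply the product inequality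
  let X : s N → Ω → ℝ := fun q => y q.1.1 q.1.2
  have hXm : ∀ q, Measurable (X q) := fun q => hmeas _ _ (hsmem N q.1 q.2).1 (hsmem N q.1 q.2).2
  have hXs : ∀ q, P.map (X q) = gaussianReal 0 1 :=
    fun q => hstd _ _ (hsmem N q.1 q.2).1 (hsmem N q.1 q.2).2
  have hXv : Measurable (fun ω q => X q ω) := measurable_pi_lambda _ hXm
  have hXg : HasGaussianLaw (fun ω q => X q ω) P := by
    refine ⟨isGaussian_of_map_eq_gaussianReal fun L => ?_⟩
    obtain ⟨v, hv⟩ := hgauss (s N) (fun q => if hq : q ∈ s N then L (Pi.single ⟨q, hq⟩ 1) else 0)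
      (hsmem N)
    refine ⟨0, v, ?_⟩
    rw [← hv, Measure.map_map L.continuous.measurable hXv]
    congr 1
    ext ω
    rw [← Finset.sum_coe_sort]
    simp only [Function.comp_apply, Finset.coe_mem, dite_true]
    conv_lhs => rw [pi_eq_sum_univ' (fun q => X q ω)]
    rw [map_sum]
    refine Finset.sum_congr rfl fun q _ => ?_
    rw [map_smul, smul_eq_mul, mul_comm]
  have hsid := sidak hXg hXm hXs (r := fun q => d q.1.1) (fun q => hdpos _) Finset.univ
  have hEeq : {ω | ∀ q ∈ (Finset.univ : Finset (s N)), |X q ω| ≤ d q.1.1} = E N := by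
    ext ω
    simp [hE, X]
  rw [hEeq] at hsid
  refine le_trans ?_ hsid
  rw [Finset.prod_coe_sort (s N) (fun q => gaussianReal 0 1 (Icc (-d q.1) (d q.1)))]
  set b : ℕ → ℝ := fun j => c * (2 ^ (-(h * ((j : ℝ) - m))) * ((2 : ℝ) ^ (-(h / 2))) ^ |(j : ℝ) - m|)
    with hb
  have hb0 : ∀ j, 0 ≤ b j := fun j => by simp only [hb]; positivity
  calc ENNReal.ofReal (Real.exp (-(M * c * D + 1) * 2 ^ (h * m)))
      ≤ ENNReal.ofReal (Real.exp (∑ q ∈ s N, -b q.1)) := by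
        refine ENNReal.ofReal_le_ofReal (Real.exp_le_exp.2 ?_)
        rw [Finset.sum_neg_distrib, neg_mul, neg_le_neg_iff]
        have hT : (0 : ℝ) < 2 ^ (h * m) := by positivity
        calc ∑ q ∈ s N, b q.1
            = ∑ j ∈ Finset.range N, ∑ n ∈ Finset.range N,
                if 1 ≤ n ∧ (n : ℝ) ≤ M * 2 ^ (h * j) then b j else 0 := by
              rw [hs, Finset.sum_filter, Finset.sum_product]
          _ ≤ ∑ j ∈ Finset.range N, M * c * 2 ^ (h * m) * ((2 : ℝ) ^ (-(h / 2))) ^ |(j : ℝ) - m| := by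
              refine Finset.sum_le_sum fun j _ => ?_
              rw [← Finset.sum_filter, Finset.sum_const, nsmul_eq_mul]
              have hcard : (((Finset.range N).filter
                  (fun n : ℕ => 1 ≤ n ∧ (n : ℝ) ≤ M * 2 ^ (h * j))).card : ℝ) ≤ M * 2 ^ (h * j) := by
                refine le_trans ?_ (Nat.floor_le (by positivity : 0 ≤ M * 2 ^ (h * (j : ℝ))))
                have := Finset.card_le_card (s := (Finset.range N).filter
                  (fun n : ℕ => 1 ≤ n ∧ (n : ℝ) ≤ M * 2 ^ (h * j)))
                  (t := Finset.Icc 1 ⌊M * 2 ^ (h * (j : ℝ))⌋₊) (by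
                    intro n hn
                    rw [Finset.mem_filter] at hn
                    exact Finset.mem_Icc.2 ⟨hn.2.1, Nat.le_floor hn.2.2⟩)
                rw [Nat.card_Icc, Nat.add_sub_cancel] at this
                exact_mod_cast this
              refine (mul_le_mul_of_nonneg_right hcard (hb0 j)).trans_eq ?_
              have e : (2 : ℝ) ^ (h * (m : ℝ)) = 2 ^ (h * (j : ℝ)) * 2 ^ (-(h * ((j : ℝ) - m))) := by
                rw [← Real.rpow_add two_pos]; congr 1; ring
              rw [e, hb]
              ring
          _ = M * c * 2 ^ (h * m) * ∑ j ∈ Finset.range N, ((2 : ℝ) ^ (-(h / 2))) ^ |(j : ℝ) - m| := by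
              rw [Finset.mul_sum]
          _ ≤ M * c * 2 ^ (h * m) * D := by
              gcongr
              exact hsum N m
          _ ≤ _ := by nlinarith
    _ = ∏ q ∈ s N, ENNReal.ofReal (Real.exp (-b q.1)) := by
        rw [Real.exp_sum, ENNReal.ofReal_prod_of_nonneg (fun _ _ => (Real.exp_pos _).le)]
    _ ≤ _ := by
        refine Finset.prod_le_prod' fun q _ => ?_
        exact hlev _
end

section
/- Let (B_t)_{t∈[0,1]} be a standard Brownian motion with continuous sample paths and let p > 2. Let V_p(B; [0,1]) = sup{ (Σ_{i=1}^n |B_{t_i} − B_{t_{i−1}}|^p)^{1/p} : n ≥ 1, 0 ≤ t_0 < t_1 < … < t_n ≤ 1 } denote the strong p-variation of B on [0,1]. Then there exists K ∈ (0, ∞) such that lim_{ε↓0} ε^{2p/(p−2)} · log P[V_p(B; [0,1]) ≤ ε] = −K. -/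
open MeasureTheory ProbabilityTheory Filter Set
open scoped ENNReal NNReal Topology

/-- The strong `p`-variation of `f` on the set `I`: the supremum, over all finite
increasing sequences `t 0 < t 1 < ⋯ < t n` of points of `I`, of
`(Σ_{i<n} |f (t (i+1)) - f (t i)|^p)^{1/p}` (with values in `ℝ≥0∞`). -/
noncomputable def pVar (p : ℝ) (f : ℝ → ℝ) (I : Set ℝ) : ℝ≥0∞ :=
  ⨆ (n : ℕ) (t : ℕ → ℝ) (_ : ∀ i ≤ n, t i ∈ I) (_ : ∀ i < n, t i < t (i + 1)),
    (∑ i ∈ Finset.range n, (ENNReal.ofReal |f (t (i + 1)) - f (t i)|) ^ p) ^ (1 / p)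

/-- The `p`-th power of the strong `p`-variation on `[0,T]`, along weakly monotone sequences. -/
noncomputable def pv (p : ℝ) (f : ℝ≥0 → ℝ) (T : ℝ≥0) : ℝ≥0∞ :=
  ⨆ (n : ℕ) (t : ℕ → ℝ≥0) (_ : Monotone t) (_ : ∀ i, t i ≤ T),
    ∑ i ∈ Finset.range n, (ENNReal.ofReal |f (t (i + 1)) - f (t i)|) ^ p

lemma le_pv (p : ℝ) (f : ℝ≥0 → ℝ) (T : ℝ≥0) (n : ℕ) (t : ℕ → ℝ≥0) (ht : Monotone t)
    (hT : ∀ i, t i ≤ T) :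
    ∑ i ∈ Finset.range n, (ENNReal.ofReal |f (t (i + 1)) - f (t i)|) ^ p ≤ pv p f T :=
  le_iSup_of_le n <| le_iSup_of_le t <| le_iSup_of_le ht <| le_iSup_of_le hT le_rfl

lemma pv_le {p : ℝ} {f : ℝ≥0 → ℝ} {T : ℝ≥0} {C : ℝ≥0∞}
    (h : ∀ (n : ℕ) (t : ℕ → ℝ≥0), Monotone t → (∀ i, t i ≤ T) →
      ∑ i ∈ Finset.range n, (ENNReal.ofReal |f (t (i + 1)) - f (t i)|) ^ p ≤ C) :
    pv p f T ≤ C :=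
  iSup_le fun n => iSup_le fun t => iSup_le fun h1 => iSup_le fun h2 => h n t h1 h2

lemma pv_mono (p : ℝ) (f : ℝ≥0 → ℝ) {S T : ℝ≥0} (h : S ≤ T) : pv p f S ≤ pv p f T :=
  pv_le fun n t h1 h2 => le_pv p f T n t h1 fun i => (h2 i).trans h

lemma pv_ge_incr (p : ℝ) (f : ℝ≥0 → ℝ) {s t T : ℝ≥0} (hst : s ≤ t) (htT : t ≤ T) :
    (ENNReal.ofReal |f t - f s|) ^ p ≤ pv p f T := by
  have := le_pv p f T 1 (fun i => if i = 0 then s else t)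
    (by
      intro i j hij
      by_cases hi : i = 0 <;> by_cases hj : j = 0 <;> simp [hi, hj, hst]
      omega)
    (by intro i; by_cases hi : i = 0 <;> simp [hi, htT, hst.trans htT])
  simpa using this

lemma pv_add_le {p : ℝ} {f : ℝ≥0 → ℝ} {T : ℝ≥0} {b C : ℝ≥0∞}
    (h : ∀ (n : ℕ) (t : ℕ → ℝ≥0), Monotone t → (∀ i, t i ≤ T) →
      ∑ i ∈ Finset.range n, (ENNReal.ofReal |f (t (i + 1)) - f (t i)|) ^ p + b ≤ C) :
    pv p f T + b ≤ C := by
  have hb : b ≤ C := by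
    simpa using h 0 (fun _ => 0) monotone_const (fun _ => zero_le)
  by_cases hbt : b = ⊤
  · subst hbt
    rw [top_le_iff] at hb
    rw [hb]; exact le_top
  · have : pv p f T ≤ C - b :=
      pv_le fun n t h1 h2 => ENNReal.le_sub_of_add_le_right hbt (h n t h1 h2)
    exact add_le_of_le_tsub_right_of_le hb this

lemma pv_superadd (p : ℝ) (f : ℝ≥0 → ℝ) (S T : ℝ≥0) :
    pv p f S + pv p (fun t => f (S + t) - f S) T ≤ pv p f (S + T) := by
  apply pv_add_le
  intro n t ht hT
  rw [add_comm]
  apply pv_add_le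
  intro m u hu hU
  have := le_pv p f (S + T) (n + 1 + m) (fun i => if i ≤ n then t i else S + u (i - (n + 1)))
    (by
      intro i j hij
      by_cases hj : j ≤ n
      · simp [hj, hij.trans hj, ht hij]
      · by_cases hi : i ≤ n
        · simp only [hi, hj, if_true, if_false]
          exact (hT i).trans le_self_add
        · simp only [hi, hj, if_false]
          gcongr
          exact hu (by omega))
    (by
      intro i
      by_cases hi : i ≤ n
      · simp only [hi, if_true]
        exact (hT i).trans le_self_add
      · simp only [hi, if_false]
        gcongr
        exact hU _)
  refine le_trans ?_ this
  rw [Finset.sum_range_add, Finset.sum_range_succ, add_comm]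
  refine add_le_add (le_trans (le_of_eq ?_) le_self_add) (le_of_eq ?_)
  · refine Finset.sum_congr rfl fun i hi => ?_
    have := Finset.mem_range.1 hi
    rw [if_pos (by omega), if_pos (by omega)]
  · refine Finset.sum_congr rfl fun i hi => ?_
    rw [if_neg (by omega), if_neg (by omega), sub_sub_sub_cancel_right]
    congr 5
    · congr 2; omega
    · congr 2; omega

lemma pv_subadd {p : ℝ} (hp : 0 < p) (f : ℝ≥0 → ℝ) (S T : ℝ≥0) (D : ℝ)
    (hD : ∀ s t, s ≤ S → t ≤ S + T → |f t - f s| ≤ D) :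
    pv p f (S + T) ≤ pv p f S + pv p (fun t => f (S + t) - f S) T + (ENNReal.ofReal D) ^ p := by
  apply pv_le
  intro n t ht hT
  have h1 := le_pv p f S n (fun i => min (t i) S) (fun i j h => min_le_min_right _ (ht h))
    (fun i => min_le_right _ _)
  have h2 := le_pv p (fun t => f (S + t) - f S) T n (fun i => t i - S)
    (fun i j h => tsub_le_tsub_right (ht h) _) (fun i => by
      rw [tsub_le_iff_left]; exact hT i)
  have h3 : ∀ m : ℕ, ∑ i ∈ Finset.range m, (if t i ≤ S ∧ S < t (i+1) then (1:ℝ≥0∞) else 0) +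
      (if t m ≤ S then 1 else 0) ≤ 1 := by
    intro m
    induction m with
    | zero => simp; split_ifs <;> simp
    | succ m ih =>
      rw [Finset.sum_range_succ, add_assoc]
      refine le_trans (add_le_add le_rfl ?_) ih
      have := ht (Nat.le_succ m)
      by_cases h : t m ≤ S
      · by_cases h' : t (m+1) ≤ S
        · simp [h, h', not_lt.2 h']
        · simp [h, h', not_le.1 h']
      · have h' : ¬ t (m+1) ≤ S := fun h' => h (this.trans h')
        simp [h, h']
  have h4 : ∑ i ∈ Finset.range n, (if t i ≤ S ∧ S < t (i+1) then (1:ℝ≥0∞) else 0) ≤ 1 :=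
    le_trans le_self_add (h3 n)
  calc _ ≤ ∑ i ∈ Finset.range n, ((ENNReal.ofReal |f (min (t (i + 1)) S) - f (min (t i) S)|) ^ p
        + (ENNReal.ofReal |(f (S + (t (i + 1) - S)) - f S) - (f (S + (t i - S)) - f S)|) ^ p
        + (if t i ≤ S ∧ S < t (i+1) then (1:ℝ≥0∞) else 0) * (ENNReal.ofReal D) ^ p) := by
        apply Finset.sum_le_sum
        intro i _
        have := ht (Nat.le_succ i)
        simp only [Nat.succ_eq_add_one] at this
        by_cases h : t i ≤ S
        · by_cases h' : t (i+1) ≤ S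
          · rw [min_eq_left h, min_eq_left h', add_assoc]
            exact le_self_add
          · rw [if_pos ⟨h, not_le.1 h'⟩, one_mul]
            refine le_trans ?_ le_add_self
            gcongr
            exact hD _ _ h (hT _)
        · have h' : ¬ t (i+1) ≤ S := fun h' => h (this.trans h')
          rw [add_tsub_cancel_of_le (not_le.1 h).le, add_tsub_cancel_of_le (not_le.1 h').le,
            sub_sub_sub_cancel_right]
          refine le_trans ?_ le_self_add
          exact le_add_self
    _ ≤ _ := by
        rw [Finset.sum_add_distrib, Finset.sum_add_distrib, ← Finset.sum_mul]
        gcongr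
        exact mul_le_of_le_one_left' h4

lemma pv_scale_le {p : ℝ} (hp : 0 < p) (f : ℝ≥0 → ℝ) (c : ℝ) (a T : ℝ≥0) :
    pv p (fun t => c * f (a * t)) T ≤ (ENNReal.ofReal |c|) ^ p * pv p f (a * T) := by
  apply pv_le
  intro n t ht hT
  have := le_pv p f (a * T) n (fun i => a * t i) (fun i j h => mul_le_mul_right (ht h) a)
    (fun i => mul_le_mul_right (hT i) a)
  refine le_trans (le_of_eq ?_) (mul_le_mul_right this _)
  rw [Finset.mul_sum]
  refine Finset.sum_congr rfl fun i _ => ?_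
  rw [← mul_sub, abs_mul, ENNReal.ofReal_mul (abs_nonneg _), ENNReal.mul_rpow_of_nonneg _ _ hp.le]

lemma pv_scale {p : ℝ} (hp : 0 < p) (f : ℝ≥0 → ℝ) {c : ℝ} (hc : c ≠ 0) {a : ℝ≥0} (ha : a ≠ 0)
    (T : ℝ≥0) :
    pv p (fun t => c * f (a * t)) T = (ENNReal.ofReal |c|) ^ p * pv p f (a * T) := by
  refine le_antisymm (pv_scale_le hp f c a T) ?_
  have := pv_scale_le hp (fun t => c * f (a * t)) c⁻¹ a⁻¹ (a * T)
  simp only [mul_inv_cancel_left₀ ha, inv_mul_cancel_left₀ hc, inv_mul_cancel_left₀ ha] at this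
  refine le_trans (mul_le_mul_right this _) ?_
  rw [← mul_assoc, ← ENNReal.mul_rpow_of_nonneg _ _ hp.le, ← ENNReal.ofReal_mul (abs_nonneg _),
    ← abs_mul, mul_inv_cancel₀ hc]
  simp

lemma pv_eq_countable {p : ℝ} (hp : 0 < p) {f : ℝ≥0 → ℝ} (hf : Continuous f) (T : ℝ≥0) :
    pv p f T = ⨆ (n : ℕ) (q : {q : Fin (n + 1) → ℚ≥0 // Monotone q ∧ ∀ i, q i ≤ 1}),
      ∑ i : Fin n, (ENNReal.ofReal |f (T * (q.1 i.succ : ℝ≥0)) - f (T * (q.1 i.castSucc : ℝ≥0))|) ^ p := by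
  apply le_antisymm
  · apply pv_le
    intro n t ht hT
    rcases eq_or_ne T 0 with rfl | hT0
    · have : ∀ i, t i = 0 := fun i => le_antisymm (hT i) zero_le
      simp [this, ENNReal.zero_rpow_of_pos hp]
    -- approximations
    have hTpos : 0 < T := pos_of_ne_zero hT0
    let q : ℕ → ℕ → ℚ≥0 := fun m i => (⌊((t i / T : ℝ≥0) : ℝ) * (m : ℝ)⌋₊ : ℚ≥0) / (m : ℚ≥0)
    have hq : ∀ i, Tendsto (fun m => T * ((q m i : ℚ≥0) : ℝ≥0)) atTop (𝓝 (t i)) := by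
      intro i
      have h1 := tendsto_nat_floor_mul_div_atTop (R := ℝ) (a := ((t i / T : ℝ≥0) : ℝ)) (NNReal.coe_nonneg _)
      have h2 : Tendsto (fun m => ((q m i : ℚ≥0) : ℝ≥0)) atTop (𝓝 (t i / T)) := by
        rw [← NNReal.tendsto_coe]
        refine (h1.comp tendsto_natCast_atTop_atTop).congr fun m => ?_
        simp [q]
      have h3 := h2.const_mul T
      rwa [mul_div_cancel₀ _ hT0] at h3
    have hmono : ∀ m, Monotone (q m) := by
      intro m i j hij
      simp only [q]
      gcongr
      exact ht hij
    have hle : ∀ m i, q m i ≤ 1 := by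
      intro m i
      simp only [q]
      apply div_le_one_of_le₀ _ zero_le
      have h1 : ⌊((t i / T : ℝ≥0) : ℝ) * (m : ℝ)⌋₊ ≤ m := by
        have : ((t i / T : ℝ≥0) : ℝ) * (m : ℝ) ≤ m := by
          apply mul_le_of_le_one_left (Nat.cast_nonneg _)
          exact_mod_cast div_le_one_of_le₀ (hT i) zero_le
        calc _ ≤ ⌊(m : ℝ)⌋₊ := Nat.floor_le_floor this
          _ = m := Nat.floor_natCast m
      exact_mod_cast h1
    have hlim : Tendsto (fun m => ∑ i ∈ Finset.range n,
        (ENNReal.ofReal |f (T * ((q m (i+1) : ℚ≥0) : ℝ≥0)) - f (T * ((q m i : ℚ≥0) : ℝ≥0))|) ^ p) atTop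
        (𝓝 (∑ i ∈ Finset.range n, (ENNReal.ofReal |f (t (i + 1)) - f (t i)|) ^ p)) := by
      apply tendsto_finsetSum
      intro i _
      apply Tendsto.ennrpow_const
      apply ENNReal.tendsto_ofReal
      apply Tendsto.abs
      exact ((hf.tendsto _).comp (hq (i+1))).sub ((hf.tendsto _).comp (hq i))
    refine le_of_tendsto hlim (Eventually.of_forall fun m => ?_)
    refine le_iSup_of_le n (le_iSup_of_le ⟨fun i => q m i, fun i j h => hmono m h, fun i => hle m i⟩ ?_)
    rw [Finset.sum_range]
    rfl
  · refine iSup_le fun n => iSup_le fun q => ?_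
    have := le_pv p f T n (fun i => T * (q.1 ⟨min i n, by omega⟩ : ℝ≥0))
      (by
        intro i j hij
        have : q.1 ⟨min i n, by omega⟩ ≤ q.1 ⟨min j n, by omega⟩ := q.2.1 (by
          simp only [Fin.mk_le_mk]; omega)
        dsimp only
        gcongr)
      (by
        intro i
        apply mul_le_of_le_one_right'
        exact_mod_cast q.2.2 _)
    refine le_trans (le_of_eq ?_) this
    rw [Finset.sum_range]
    refine Finset.sum_congr rfl fun i _ => ?_
    have h1 : (⟨min (i+1) n, by omega⟩ : Fin (n+1)) = i.succ := by
      ext; simp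
    have h2 : (⟨min i n, by omega⟩ : Fin (n+1)) = i.castSucc := by
      ext; simp
    rw [h1, h2]

lemma measurable_pv {Ω : Type*} {m : MeasurableSpace Ω} {p : ℝ} (hp : 0 < p)
    {X : ℝ≥0 → Ω → ℝ} (hc : ∀ ω, Continuous fun t => X t ω) (T : ℝ≥0)
    (hX : ∀ t ≤ T, Measurable (X t)) : Measurable fun ω => pv p (fun t => X t ω) T := by
  simp_rw [fun ω => pv_eq_countable hp (hc ω) T]
  refine Measurable.iSup fun n => Measurable.iSup fun q => ?_
  refine Finset.measurable_sum _ fun i _ => ?_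
  have h : ∀ i, Measurable (X (T * (q.1 i : ℝ≥0))) := fun i => hX _ (by
    apply mul_le_of_le_one_right'
    exact_mod_cast q.2.2 _)
  have h1 := h i.succ
  have h2 := h i.castSucc
  apply Measurable.pow_const
  apply Measurable.ennreal_ofReal
  exact (h1.sub h2).abs

lemma strict_of_mono {p : ℝ} (hp : 0 < p) (f : ℝ → ℝ) (t : ℕ → ℝ≥0) (ht : Monotone t)
    (hT : ∀ i, t i ≤ 1) (n : ℕ) : ∃ (k : ℕ) (u : ℕ → ℝ), (∀ i ≤ k, u i ∈ Set.Icc (0:ℝ) 1) ∧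
      (∀ i < k, u i < u (i + 1)) ∧ u k = t n ∧
      ∑ i ∈ Finset.range n, (ENNReal.ofReal |f (t (i + 1)) - f (t i)|) ^ p =
      ∑ i ∈ Finset.range k, (ENNReal.ofReal |f (u (i + 1)) - f (u i)|) ^ p := by
  induction n with
  | zero =>
    refine ⟨0, fun _ => t 0, fun i _ => ⟨(t 0).2, ?_⟩, by simp, rfl, by simp⟩
    exact_mod_cast hT 0
  | succ n ih =>
    obtain ⟨k, u, h1, h2, h3, h4⟩ := ih
    rcases (ht (Nat.le_succ n)).eq_or_lt with h | h
    · refine ⟨k, u, h1, h2, by rw [h3, h], ?_⟩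
      rw [Finset.sum_range_succ, h4, ← Nat.succ_eq_add_one, ← h]
      simp [ENNReal.zero_rpow_of_pos hp]
    · refine ⟨k + 1, fun i => if i ≤ k then u i else t (n + 1), ?_, ?_, by simp, ?_⟩
      · intro i hi
        by_cases h : i ≤ k
        · simpa only [h, if_true] using h1 i h
        · simp only [h, if_false]
          exact ⟨(t _).2, by exact_mod_cast hT _⟩
      · intro i hi
        by_cases h' : i + 1 ≤ k
        · simpa only [h', (by omega : i ≤ k), if_true] using h2 i h'
        · have : i = k := by omega
          subst this
          simpa [h3] using h
      · rw [Finset.sum_range_succ, Finset.sum_range_succ, h4]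
        congr 1
        · refine Finset.sum_congr rfl fun i hi => ?_
          have := Finset.mem_range.1 hi
          dsimp only
          rw [if_pos (by omega), if_pos (by omega)]
        · simp [h3]

lemma pVar_le_iff {p : ℝ} (hp : 0 < p) (f : ℝ → ℝ) (x : ℝ≥0∞) :
    pVar p f (Set.Icc 0 1) ≤ x ↔ pv p (fun t => f t) 1 ≤ x ^ p := by
  constructor
  · intro h
    apply pv_le
    intro n t ht hT
    obtain ⟨k, u, h1, h2, h3, h4⟩ := strict_of_mono hp f t ht hT n
    rw [h4]
    rw [← ENNReal.rpow_inv_le_iff hp, ← one_div]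
    refine le_trans ?_ h
    exact le_iSup_of_le k <| le_iSup_of_le u <| le_iSup_of_le h1 <| le_iSup_of_le h2 le_rfl
  · intro h
    refine iSup_le fun n => iSup_le fun t => iSup_le fun h1 => iSup_le fun h2 => ?_
    rw [one_div, ENNReal.rpow_inv_le_iff hp]
    refine le_trans ?_ h
    have hm : Monotone fun i => t (min i n) := by
      apply monotone_nat_of_le_succ
      intro i
      by_cases hi : i < n
      · rw [min_eq_left hi.le, min_eq_left (by omega)]
        exact (h2 i hi).le
      · rw [min_eq_right (by omega), min_eq_right (by omega)]
    have := le_pv p (fun t => f t) 1 n (fun i => (t (min i n)).toNNReal)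
      (fun i j h => Real.toNNReal_le_toNNReal (hm h))
      (fun i => by
        rw [Real.toNNReal_le_one]
        exact (h1 _ (by omega)).2)
    refine le_trans (le_of_eq ?_) this
    refine Finset.sum_congr rfl fun i hi => ?_
    have := Finset.mem_range.1 hi
    rw [min_eq_left (by omega), min_eq_left (by omega), Real.coe_toNNReal _ (h1 _ (by omega)).1,
      Real.coe_toNNReal _ (h1 _ (by omega)).1]


lemma eventually_gt_of_deriv_pos {F : ℝ → ℝ} {d : ℝ} (hF : HasDerivAt F d 0) (hd : 0 < d) :
    ∀ᶠ h in 𝓝[>] (0:ℝ), F 0 < F h := by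
  have h1 := hasDerivAt_iff_tendsto_slope.1 hF
  have h2 : Tendsto (slope F 0) (𝓝[>] 0) (𝓝 d) :=
    h1.mono_left (nhdsWithin_mono _ (fun x hx => ne_of_gt hx))
  filter_upwards [h2.eventually (lt_mem_nhds hd), self_mem_nhdsWithin] with h hh (hp : 0 < h)
  rw [slope_def_field, sub_zero] at hh
  have := (div_pos_iff_of_pos_right hp).1 hh
  linarith

section tauber
variable {Ω : Type*} [MeasurableSpace Ω] {P : Measure Ω} [IsProbabilityMeasure P]
  {Y : Ω → ℝ}

lemma integrable_exp_neg (hY : Measurable Y) (hY0 : ∀ ω, 0 ≤ Y ω) {l : ℝ} (hl : 0 ≤ l) :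
    Integrable (fun ω => Real.exp (-(l * Y ω))) P := by
  refine Integrable.of_bound (C := 1) (by fun_prop) (Eventually.of_forall fun ω => ?_)
  rw [Real.norm_of_nonneg (Real.exp_pos _).le, Real.exp_le_one_iff]
  have := mul_nonneg hl (hY0 ω)
  linarith

lemma tauber_upper (hY : Measurable Y) (hY0 : ∀ ω, 0 ≤ Y ω) {x l : ℝ} (hl : 0 ≤ l) :
    P.real {ω | Y ω ≤ x} ≤ Real.exp (l * x) * ∫ ω, Real.exp (-(l * Y ω)) ∂P := by
  have hm : MeasurableSet {ω | Y ω ≤ x} := measurableSet_le hY measurable_const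
  rw [← integral_indicator_one hm, ← integral_const_mul]
  apply integral_mono ((integrable_const (1:ℝ)).indicator hm)
    ((integrable_exp_neg hY hY0 hl).const_mul _)
  intro ω
  dsimp only
  rw [← Real.exp_add]
  by_cases h : ω ∈ {ω | Y ω ≤ x}
  · rw [indicator_of_mem h]
    change (1:ℝ) ≤ _
    rw [Real.one_le_exp_iff]
    have := mul_le_mul_of_nonneg_left (show Y ω ≤ x from h) hl
    linarith
  · rw [indicator_of_notMem h]
    exact (Real.exp_pos _).le

lemma tauber_lower (hY : Measurable Y) (hY0 : ∀ ω, 0 ≤ Y ω) {x y l k : ℝ} (hk : 0 ≤ k)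
    (hkl : k ≤ l) :
    ∫ ω, Real.exp (-(l * Y ω)) ∂P ≤
      Real.exp (-(k * x)) * ∫ ω, Real.exp (-((l - k) * Y ω)) ∂P +
      Real.exp (k * y) * ∫ ω, Real.exp (-((l + k) * Y ω)) ∂P +
      Real.exp (-(l * y)) * P.real {ω | Y ω ≤ x} := by
  have hm : MeasurableSet {ω | Y ω ≤ x} := measurableSet_le hY measurable_const
  have i1 := (integrable_exp_neg (P := P) hY hY0 (sub_nonneg.2 hkl)).const_mul (Real.exp (-(k * x)))
  have i2 := (integrable_exp_neg (P := P) hY hY0 (l := l + k) (by linarith)).const_mul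
    (Real.exp (k * y))
  have i3 : Integrable (fun ω => Real.exp (-(l * y)) * ({ω | Y ω ≤ x}.indicator 1 ω : ℝ)) P :=
    ((integrable_const (1:ℝ)).indicator hm).const_mul _
  rw [← integral_indicator_one hm, ← integral_const_mul, ← integral_const_mul,
    ← integral_const_mul, ← integral_add i1 i2]
  refine le_trans ?_ (integral_add (i1.add i2) i3).le
  apply integral_mono (integrable_exp_neg hY hY0 (hk.trans hkl)) ((i1.add i2).add i3)
  intro ω
  dsimp only [Pi.add_apply]
  rw [← Real.exp_add, ← Real.exp_add]
  have p1 := Real.exp_pos (-(k * x) + -((l - k) * Y ω))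
  have p2 := Real.exp_pos (k * y + -((l + k) * Y ω))
  have p3 := Real.exp_pos (-(l * y))
  by_cases h : Y ω ≤ x
  · rw [indicator_of_mem (show ω ∈ {ω | Y ω ≤ x} from h)]
    simp only [Pi.one_apply, mul_one]
    by_cases h' : y ≤ Y ω
    · have : Real.exp (-(l * Y ω)) ≤ Real.exp (-(l * y)) := by
        apply Real.exp_le_exp.2
        have := mul_le_mul_of_nonneg_left h' (hk.trans hkl)
        linarith
      linarith
    · have : Real.exp (-(l * Y ω)) ≤ Real.exp (k * y + -((l + k) * Y ω)) := by
        apply Real.exp_le_exp.2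
        have := mul_le_mul_of_nonneg_left (not_le.1 h').le hk
        linarith
      linarith
  · rw [indicator_of_notMem (show ω ∉ {ω | Y ω ≤ x} from h), mul_zero]
    have : Real.exp (-(l * Y ω)) ≤ Real.exp (-(k * x) + -((l - k) * Y ω)) := by
      apply Real.exp_le_exp.2
      have := mul_le_mul_of_nonneg_left (not_le.1 h).le hk
      linarith
    linarith

set_option maxHeartbeats 1000000 in
theorem tauber (hY : Measurable Y) (hY0 : ∀ ω, 0 ≤ Y ω) {a C : ℝ} (ha : 0 < a) (ha1 : a < 1)
    (hC : 0 < C)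
    (h : Tendsto (fun l : ℝ => Real.log (∫ ω, Real.exp (-(l * Y ω)) ∂P) / l ^ a) atTop (𝓝 (-C))) :
    ∃ K : ℝ, 0 < K ∧ Tendsto (fun x : ℝ => x ^ (a / (1 - a)) * Real.log (P.real {ω | Y ω ≤ x}))
      (𝓝[>] 0) (𝓝 (-K)) := by
  have ha' : 0 < 1 - a := by linarith
  set b := a / (1 - a) with hb
  have hbpos : 0 < b := div_pos ha ha'
  have hab : a * (b + 1) = b := by rw [hb]; field_simp; ring
  set Φ : ℝ → ℝ := fun l => ∫ ω, Real.exp (-(l * Y ω)) ∂P with hΦ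
  have hΦpos : ∀ l, 0 ≤ l → 0 < Φ l := fun l hl =>
    integral_exp_pos (integrable_exp_neg hY hY0 hl)
  -- rescaled limit
  have hs : ∀ s : ℝ, 0 < s → Tendsto (fun x : ℝ => x ^ b * Real.log (Φ (s * x ^ (-(b+1)))))
      (𝓝[>] 0) (𝓝 (-(C * s ^ a))) := by
    intro s hs
    have h1 : Tendsto (fun x : ℝ => s * x ^ (-(b+1))) (𝓝[>] 0) atTop :=
      (tendsto_rpow_neg_nhdsGT_zero (by linarith)).const_mul_atTop hs
    have h2 := (h.comp h1).mul_const (s ^ a)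
    rw [neg_mul] at h2
    refine h2.congr' ?_
    filter_upwards [self_mem_nhdsWithin] with x (hx : 0 < x)
    simp only [Function.comp]
    rw [Real.mul_rpow hs.le (Real.rpow_nonneg hx.le _), ← Real.rpow_mul hx.le,
      show -(b+1) * a = -b by linarith, Real.rpow_neg hx.le b]
    have h5 := Real.rpow_pos_of_pos hs a
    have h6 := Real.rpow_pos_of_pos hx b
    change Real.log (Φ (s * x ^ (-(b+1)))) / _ * _ = _
    generalize Real.log (Φ (s * x ^ (-(b+1)))) = w
    generalize x ^ b = u at *
    generalize s ^ a = v at *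
    field_simp
  set s0 := (a * C) ^ (1 / (1 - a)) with hs0
  have haC : 0 < a * C := mul_pos ha hC
  have hs0pos : 0 < s0 := Real.rpow_pos_of_pos haC _
  have hs0eq : a * C * s0 ^ (a - 1) = 1 := by
    rw [hs0, ← Real.rpow_mul haC.le, show 1 / (1 - a) * (a - 1) = -1 by field_simp; ring,
      Real.rpow_neg_one, mul_inv_cancel₀ haC.ne']
  have hs0a : s0 ^ a = s0 / (a * C) := by
    have : s0 ^ a = s0 * s0 ^ (a - 1) := by
      rw [Real.rpow_sub_one hs0pos.ne']; field_simp
    rw [this]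
    field_simp
    linarith
  have hK : C * s0 ^ a - s0 = s0 * (1 / a - 1) := by
    rw [hs0a]; field_simp
  -- lower bound
  have hlow : ∀ c < -(C * s0 ^ a - s0), ∀ᶠ x in 𝓝[>] (0:ℝ),
      Real.exp (c * x ^ (-b)) ≤ P.real {ω | Y ω ≤ x} := by
    intro c hc
    obtain ⟨d, hd, hd'⟩ : ∃ d : ℝ, 0 < d ∧
        c < (s0 + d) * (a * C * (s0 + d) ^ (a - 1) - d) - C * (s0 + d) ^ a := by
      have ht : Tendsto (fun d : ℝ => (s0 + d) * (a * C * (s0 + d) ^ (a - 1) - d)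
          - C * (s0 + d) ^ a) (𝓝[>] 0) (𝓝 ((s0 + 0) * (a * C * (s0 + 0) ^ (a - 1) - 0)
          - C * (s0 + 0) ^ a)) := by
        apply Tendsto.mono_left _ nhdsWithin_le_nhds
        have : ContinuousAt (fun d : ℝ => (s0 + d) * (a * C * (s0 + d) ^ (a - 1) - d)
          - C * (s0 + d) ^ a) 0 := by
          have e : ∀ e : ℝ, ContinuousAt (fun d : ℝ => (s0 + d) ^ e) 0 := fun e =>
            ContinuousAt.rpow_const (by fun_prop) (Or.inl (by simpa using hs0pos.ne'))
          have e1 := e (a-1)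
          have e2 := e a
          fun_prop
        exact this
      simp only [add_zero, sub_zero, hs0eq] at ht
      have := ht.eventually (lt_mem_nhds (a := c) (by linarith))
      obtain ⟨d, hd1, hd2⟩ := (this.and self_mem_nhdsWithin).exists
      exact ⟨d, hd2, hd1⟩
    set s := s0 + d with hsd
    have hspos : 0 < s := by positivity
    set z1 := a * C * s ^ (a - 1) with hz1
    have hz1lt : z1 < 1 := by
      rw [← hs0eq, hz1]
      apply mul_lt_mul_of_pos_left _ haC
      exact Real.rpow_lt_rpow_of_neg hs0pos (by linarith) (by linarith)
    have hder : HasDerivAt (fun u : ℝ => C * u ^ a) z1 s := by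
      have := (Real.hasDerivAt_rpow_const (x := s) (p := a) (Or.inl hspos.ne')).const_mul C
      exact this.congr_deriv (by rw [hz1]; ring)
    have hF : ∀ᶠ h in 𝓝[>] (0:ℝ), C * s ^ a < h + C * (s - h) ^ a := by
      have d1 : HasDerivAt (fun h : ℝ => h + C * (s - h) ^ a) (1 - z1) 0 := by
        have e1 : HasDerivAt (fun h : ℝ => s - h) (-1) 0 := (hasDerivAt_id 0).const_sub s
        have hder' : HasDerivAt (fun u : ℝ => C * u ^ a) z1 (s - 0) := by simpa using hder
        have e2 := (hasDerivAt_id (0:ℝ)).add (HasDerivAt.comp (0:ℝ) hder' e1)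
        exact e2.congr_deriv (by ring)
      simpa using eventually_gt_of_deriv_pos d1 (by linarith)
    have hG : ∀ᶠ h in 𝓝[>] (0:ℝ), C * s ^ a < C * (s + h) ^ a - h * (z1 - d) := by
      have d1 : HasDerivAt (fun h : ℝ => C * (s + h) ^ a - h * (z1 - d)) (z1 - (z1 - d)) 0 := by
        have e1 : HasDerivAt (fun h : ℝ => s + h) 1 0 := (hasDerivAt_id 0).const_add s
        have hder' : HasDerivAt (fun u : ℝ => C * u ^ a) z1 (s + 0) := by simpa using hder
        have e2 := (HasDerivAt.comp (0:ℝ) hder' e1).sub ((hasDerivAt_id (0:ℝ)).mul_const (z1 - d))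
        exact e2.congr_deriv (by ring)
      simpa using eventually_gt_of_deriv_pos d1 (by linarith)
    have hH : ∀ᶠ h in 𝓝[>] (0:ℝ), h < s := 
      nhdsWithin_le_nhds (gt_mem_nhds hspos)
    obtain ⟨h, ⟨⟨hF1, hG1⟩, hh⟩, hhpos : 0 < h⟩ := (((hF.and hG).and hH).and self_mem_nhdsWithin).exists
    obtain ⟨η, hη, hη1, hη2, hη3⟩ : ∃ η : ℝ, 0 < η ∧ C * s ^ a + 3 * η ≤ h + C * (s - h) ^ a ∧
        C * s ^ a + 3 * η ≤ C * (s + h) ^ a - h * (z1 - d) ∧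
        c + 2 * η ≤ s * (z1 - d) - C * s ^ a := by
      refine ⟨min (min ((h + C * (s - h) ^ a - C * s ^ a) / 3)
        ((C * (s + h) ^ a - h * (z1 - d) - C * s ^ a) / 3))
        ((s * (z1 - d) - C * s ^ a - c) / 2), ?_, ?_, ?_, ?_⟩
      · refine lt_min (lt_min ?_ ?_) ?_ <;> linarith
      all_goals
        set m := min (min ((h + C * (s - h) ^ a - C * s ^ a) / 3)
          ((C * (s + h) ^ a - h * (z1 - d) - C * s ^ a) / 3))
          ((s * (z1 - d) - C * s ^ a - c) / 2)
        have m1 : m ≤ (h + C * (s - h) ^ a - C * s ^ a) / 3 :=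
          (min_le_left _ _).trans (min_le_left _ _)
        have m2 : m ≤ (C * (s + h) ^ a - h * (z1 - d) - C * s ^ a) / 3 :=
          (min_le_left _ _).trans (min_le_right _ _)
        have m3 : m ≤ (s * (z1 - d) - C * s ^ a - c) / 2 := min_le_right _ _
        linarith
    have l1 := (hs s hspos).eventually (lt_mem_nhds (a := -(C * s ^ a) - η) (by linarith))
    have l2 := (hs (s - h) (by linarith)).eventually
      (gt_mem_nhds (a := -(C * (s - h) ^ a) + η) (by linarith))
    have l3 := (hs (s + h) (by linarith)).eventually
      (gt_mem_nhds (a := -(C * (s + h) ^ a) + η) (by linarith))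
    have l4 : ∀ᶠ x in 𝓝[>] (0:ℝ), Real.log 4 / η ≤ x ^ (-b) :=
      (tendsto_rpow_neg_nhdsGT_zero (y := -b) (by linarith)).eventually (eventually_ge_atTop _)
    filter_upwards [l1, l2, l3, l4, self_mem_nhdsWithin] with x l1 l2 l3 l4 (hx : 0 < x)
    set R := x ^ (-b) with hR
    have hRpos : 0 < R := Real.rpow_pos_of_pos hx _
    have hxb : x ^ b = R⁻¹ := by rw [hR, Real.rpow_neg hx.le, inv_inv]
    have hxb1 : x ^ (-(b+1)) = R / x := by
      rw [hR, show -(b+1) = -b - 1 by ring, Real.rpow_sub_one hx.ne']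
    rw [hxb, hxb1] at l1 l2 l3
    have q1 : Real.exp ((-(C * s ^ a) - η) * R) ≤ Φ (s * (R / x)) := by
      rw [← Real.le_log_iff_exp_le (hΦpos _ (by positivity))]
      rw [lt_inv_mul_iff₀ hRpos] at l1
      linarith
    have q2 : Φ ((s - h) * (R / x)) ≤ Real.exp ((-(C * (s - h) ^ a) + η) * R) := by
      rw [← Real.log_le_iff_le_exp (hΦpos _ (mul_nonneg (by linarith) (by positivity)))]
      rw [inv_mul_lt_iff₀ hRpos] at l2
      linarith
    have q3 : Φ ((s + h) * (R / x)) ≤ Real.exp ((-(C * (s + h) ^ a) + η) * R) := by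
      rw [← Real.log_le_iff_le_exp (hΦpos _ (mul_nonneg (by linarith) (by positivity)))]
      rw [inv_mul_lt_iff₀ hRpos] at l3
      linarith
    have main := tauber_lower (P := P) hY hY0 (x := x) (y := (z1 - d) * x) (l := s * (R / x))
      (k := h * (R / x)) (by positivity) (by gcongr)
    rw [← sub_mul, ← add_mul] at main
    change Φ _ ≤ _ * Φ _ + _ * Φ _ + _ at main
    have w1 : h * (R / x) * x = h * R := by field_simp
    have w2 : h * (R / x) * ((z1 - d) * x) = h * (z1 - d) * R := by field_simp
    have w3 : s * (R / x) * ((z1 - d) * x) = s * (z1 - d) * R := by field_simp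
    rw [w1, w2, w3] at main
    set pr := P.real {ω | Y ω ≤ x}
    have r2 : Real.exp (-(h * R)) * Φ ((s - h) * (R / x)) ≤ Real.exp ((-(C * s ^ a) - 2 * η) * R) := by
      refine (mul_le_mul_of_nonneg_left q2 (Real.exp_pos _).le).trans ?_
      rw [← Real.exp_add]
      apply Real.exp_le_exp.2
      linarith [mul_le_mul_of_nonneg_right hη1 hRpos.le]
    have r3 : Real.exp (h * (z1 - d) * R) * Φ ((s + h) * (R / x)) ≤
        Real.exp ((-(C * s ^ a) - 2 * η) * R) := by
      refine (mul_le_mul_of_nonneg_left q3 (Real.exp_pos _).le).trans ?_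
      rw [← Real.exp_add]
      apply Real.exp_le_exp.2
      linarith [mul_le_mul_of_nonneg_right hη2 hRpos.le]
    have r4 : (4:ℝ) ≤ Real.exp (η * R) := by
      rw [← Real.log_le_iff_le_exp (by norm_num)]
      rw [div_le_iff₀ hη] at l4
      linarith
    have r5 : 4 * Real.exp ((-(C * s ^ a) - 2 * η) * R) ≤ Real.exp ((-(C * s ^ a) - η) * R) := by
      rw [show (-(C * s ^ a) - η) * R = η * R + (-(C * s ^ a) - 2 * η) * R by ring, Real.exp_add]
      exact mul_le_mul_of_nonneg_right r4 (Real.exp_pos _).le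
    have r6 : Real.exp ((-(C * s ^ a) - 2 * η) * R) ≤ Real.exp (-(s * (z1 - d) * R)) * pr := by
      have := Real.exp_pos ((-(C * s ^ a) - 2 * η) * R)
      linarith
    have r7 : Real.exp (s * (z1 - d) * R) * Real.exp ((-(C * s ^ a) - 2 * η) * R) ≤ pr := by
      have := mul_le_mul_of_nonneg_left r6 (Real.exp_pos (s * (z1 - d) * R)).le
      rwa [← mul_assoc, ← Real.exp_add (s * (z1 - d) * R) (-_), add_neg_cancel, Real.exp_zero,
        one_mul] at this
    refine le_trans ?_ r7
    rw [← Real.exp_add]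
    apply Real.exp_le_exp.2
    linarith [mul_le_mul_of_nonneg_right hη3 hRpos.le]
  refine ⟨C * s0 ^ a - s0, ?_, ?_⟩
  · rw [hK]
    apply mul_pos hs0pos
    rw [sub_pos, one_div]
    exact (one_lt_inv₀ ha).2 ha1
  · have key : ∀ x : ℝ, 0 < x → x ^ (-b) * x ^ b = 1 := fun x hx => by
      rw [← Real.rpow_add hx]; simp
    rw [tendsto_order]
    constructor
    · intro c hc
      obtain ⟨c', hc1, hc2⟩ := exists_between hc
      filter_upwards [hlow c' hc2, self_mem_nhdsWithin] with x hx (hx0 : 0 < x)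
      have hp := (Real.exp_pos _).trans_le hx
      rw [← Real.le_log_iff_exp_le hp] at hx
      have := mul_le_mul_of_nonneg_left hx (Real.rpow_nonneg hx0.le b)
      have k := key x hx0
      calc c < c' := hc1
        _ = x ^ b * (c' * x ^ (-b)) := by linear_combination (-c') * k
        _ ≤ _ := this
    · intro c hc
      have l1 := (hs s0 hs0pos).eventually (gt_mem_nhds (a := c - s0) (by linarith))
      filter_upwards [hlow _ (sub_one_lt _), self_mem_nhdsWithin, l1] with x hx (hx0 : 0 < x) l1
      have hp := (Real.exp_pos _).trans_le hx
      have hu := tauber_upper (P := P) hY hY0 (x := x) (l := s0 * x ^ (-(b+1))) (by positivity)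
      have hu' := Real.log_le_log hp hu
      rw [Real.log_mul (Real.exp_pos _).ne' (hΦpos _ (by positivity)).ne', Real.log_exp] at hu'
      have := mul_le_mul_of_nonneg_left hu' (Real.rpow_nonneg hx0.le b)
      have k := key x hx0
      refine this.trans_lt ?_
      rw [mul_add]
      have e : x ^ b * (s0 * x ^ (-(b+1)) * x) = s0 := by
        rw [show -(b+1) = -b - 1 by ring, Real.rpow_sub_one hx0.ne']
        field_simp
        linear_combination k
      rw [e]
      change s0 + x ^ b * Real.log (Φ _) < c
      linarith
end tauber


/-- dyadic approximation from below -/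
noncomputable def dyad (m : ℕ) (t : ℝ≥0) : ℝ≥0 := (⌊2 ^ m * t⌋₊ : ℝ≥0) / 2 ^ m

lemma dyad_le (m : ℕ) (t : ℝ≥0) : dyad m t ≤ t := by
  unfold dyad
  rw [div_le_iff₀ (by positivity), mul_comm t]
  exact Nat.floor_le zero_le

lemma lt_dyad (m : ℕ) (t : ℝ≥0) : t ≤ dyad m t + (1/2)^m := by
  unfold dyad
  have := (Nat.lt_floor_add_one ((2:ℝ≥0) ^ m * t)).le
  rw [one_div, inv_pow, ← one_div, ← add_div, le_div_iff₀ (by positivity), mul_comm t]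
  exact this

lemma dyad_tendsto (t : ℝ≥0) : Tendsto (fun m => dyad m t) atTop (𝓝 t) := by
  have h : Tendsto (fun m : ℕ => (1/2 : ℝ)^m) atTop (𝓝 0) :=
    tendsto_pow_atTop_nhds_zero_of_lt_one (by norm_num) (by norm_num)
  rw [← NNReal.tendsto_coe]
  refine tendsto_of_tendsto_of_tendsto_of_le_of_le (g := fun m : ℕ => (t:ℝ) - (1/2)^m) (h := fun _ => (t:ℝ))
    (by simpa using tendsto_const_nhds.sub h) tendsto_const_nhds (fun m => ?_) (fun m => ?_)
  · have := lt_dyad m t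
    rw [← NNReal.coe_le_coe] at this
    push_cast at this
    simp only at *
    linarith
  · exact_mod_cast dyad_le m t

lemma dyad_step {f : ℝ≥0 → ℝ} {K r : ℝ} (hr : 0 < r) (hK : 0 ≤ K)
    (h : ∀ m k : ℕ, k < 2^m → |f (((k + 1 : ℕ) : ℝ≥0) / 2^m) - f ((k : ℝ≥0) / 2^m)| ≤ K * r ^ m)
    {t : ℝ≥0} (ht : t ≤ 1) (m : ℕ) :
    |f (dyad (m+1) t) - f (dyad m t)| ≤ K * r ^ (m+1) := by
  set j := ⌊2 ^ m * t⌋₊ with hj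
  have h1 : (j : ℝ≥0) ≤ 2 ^ m * t := Nat.floor_le zero_le
  have h2 : 2 ^ m * t < j + 1 := Nat.lt_floor_add_one _
  have e : dyad m t = ((2 * j : ℕ) : ℝ≥0) / 2 ^ (m+1) := by
    unfold dyad; rw [← hj]; push_cast; field_simp; ring
  have hj2 : 2 * j ≤ ⌊2 ^ (m+1) * t⌋₊ := by
    apply Nat.le_floor; push_cast; rw [pow_succ', mul_assoc]; gcongr
  have hj3 : ⌊2 ^ (m+1) * t⌋₊ < 2 * j + 2 := by
    rw [Nat.floor_lt zero_le]; push_cast; rw [pow_succ', mul_assoc]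
    calc 2 * (2 ^ m * t) < 2 * (j + 1) := by gcongr
      _ = _ := by ring
  rcases (by omega : ⌊2 ^ (m+1) * t⌋₊ = 2 * j ∨ ⌊2 ^ (m+1) * t⌋₊ = 2 * j + 1) with h3 | h3
  · have : dyad (m+1) t = dyad m t := by rw [e]; unfold dyad; rw [h3]
    rw [this]; simp; positivity
  · have e2 : dyad (m+1) t = ((2 * j + 1 : ℕ) : ℝ≥0) / 2 ^ (m+1) := by unfold dyad; rw [h3]
    rw [e, e2]
    apply h
    have h4 : ⌊2 ^ (m+1) * t⌋₊ ≤ 2 ^ (m+1) := by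
      apply Nat.floor_le_of_le; push_cast
      calc _ ≤ (2:ℝ≥0)^(m+1) * 1 := by gcongr
        _ = _ := by ring
    omega

lemma dyad_dist {f : ℝ≥0 → ℝ} (hf : Continuous f) {K r : ℝ} (hr : 0 < r) (hr1 : r < 1) (hK : 0 ≤ K)
    (h : ∀ m k : ℕ, k < 2^m → |f (((k + 1 : ℕ) : ℝ≥0) / 2^m) - f ((k : ℝ≥0) / 2^m)| ≤ K * r ^ m)
    {t : ℝ≥0} (ht : t ≤ 1) (m : ℕ) :
    |f (dyad m t) - f t| ≤ K * r ^ m / (1 - r) := by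
  rw [← Real.dist_eq]
  refine dist_le_of_le_geometric_of_tendsto r K hr1 (f := fun m => f (dyad m t)) (fun n => ?_)
    ((hf.tendsto t).comp (dyad_tendsto t)) m
  rw [dist_comm, Real.dist_eq]
  refine (dyad_step hr hK h ht n).trans ?_
  gcongr K * ?_
  exact pow_le_pow_of_le_one hr.le hr1.le (by omega)

lemma dyad_holder {f : ℝ≥0 → ℝ} (hf : Continuous f) {K r : ℝ} (hr : 0 < r) (hr1 : r < 1) (hK : 0 ≤ K)
    (h : ∀ m k : ℕ, k < 2^m → |f (((k + 1 : ℕ) : ℝ≥0) / 2^m) - f ((k : ℝ≥0) / 2^m)| ≤ K * r ^ m)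
    {s t : ℝ≥0} (hst : s < t) (ht : t ≤ 1) :
    ∃ m : ℕ, (1/2 : ℝ)^(m+1) < t - s ∧ |f t - f s| ≤ K * r ^ m * (1 + 2 / (1 - r)) := by
  have hst' : (s:ℝ) < t := hst
  have ht' : (t:ℝ) ≤ 1 := ht
  obtain ⟨m, hm1, hm2⟩ := exists_nat_pow_near_of_lt_one (x := (t - s : ℝ)) (y := 1/2) (by linarith)
    (by have := s.2; linarith [s.coe_nonneg]) (by norm_num) (by norm_num)
  refine ⟨m, hm1, ?_⟩
  have a1 := dyad_dist hf hr hr1 hK h ht m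
  have a2 := dyad_dist hf hr hr1 hK h (hst.le.trans ht) m
  have a3 : |f (dyad m t) - f (dyad m s)| ≤ K * r ^ m := by
    have hm3 : t ≤ s + (1/2)^m := by
      rw [← NNReal.coe_le_coe]; push_cast; linarith
    have b1 : ⌊2 ^ m * s⌋₊ ≤ ⌊2 ^ m * t⌋₊ := Nat.floor_mono (by gcongr)
    have b2 : ⌊2 ^ m * t⌋₊ ≤ ⌊2 ^ m * s⌋₊ + 1 := by
      rw [← Nat.floor_add_one zero_le]
      apply Nat.floor_mono
      calc 2 ^ m * t ≤ 2 ^ m * (s + (1/2)^m) := by gcongr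
        _ = _ := by rw [mul_add, ← mul_pow]; norm_num
    have h4 : ⌊2 ^ m * t⌋₊ ≤ 2 ^ m := by
      apply Nat.floor_le_of_le; push_cast
      calc _ ≤ (2:ℝ≥0)^m * 1 := by gcongr
        _ = _ := by ring
    unfold dyad
    rcases (by omega : ⌊2 ^ m * t⌋₊ = ⌊2 ^ m * s⌋₊ ∨ ⌊2 ^ m * t⌋₊ = ⌊2 ^ m * s⌋₊ + 1) with h3 | h3
    · rw [h3]; simp; positivity
    · rw [h3]; apply h; omega
  have : |f t - f s| ≤ K * r ^ m / (1 - r) + K * r ^ m + K * r ^ m / (1 - r) := by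
    rw [abs_le] at *
    constructor <;> linarith
  refine this.trans (le_of_eq ?_)
  ring

lemma pv_finite_of_dyad {f : ℝ≥0 → ℝ} (hf : Continuous f) {p K r : ℝ} (hp : 0 < p) (hr : 0 < r)
    (hr1 : r < 1) (hrp : r ^ p = 1/2) (hK : 0 ≤ K)
    (h : ∀ m k : ℕ, k < 2^m → |f (((k + 1 : ℕ) : ℝ≥0) / 2^m) - f ((k : ℝ≥0) / 2^m)| ≤ K * r ^ m) :
    pv p f 1 < ⊤ := by
  have h1r : 0 < 1 - r := by linarith
  set D := K * (1 + 2 / (1 - r))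
  have hD : 0 ≤ D := by positivity
  have key : ∀ s t : ℝ≥0, s ≤ t → t ≤ 1 → |f t - f s| ^ p ≤ 2 * D ^ p * (t - s) := by
    intro s t hst ht
    rcases hst.eq_or_lt with rfl | hst
    · simp [hp.ne']
    obtain ⟨m, hm1, hm2⟩ := dyad_holder hf hr hr1 hK h hst ht
    calc |f t - f s| ^ p ≤ (D * r ^ m) ^ p := by
          apply Real.rpow_le_rpow (abs_nonneg _) _ hp.le
          refine hm2.trans (le_of_eq ?_)
          simp only [D]; ring
      _ = D ^ p * (1/2)^m := by
          rw [Real.mul_rpow hD (by positivity), ← hrp, ← Real.rpow_natCast, ← Real.rpow_natCast,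
            ← Real.rpow_mul hr.le, ← Real.rpow_mul hr.le, mul_comm p]
      _ = 2 * D ^ p * (1/2)^(m+1) := by ring
      _ ≤ _ := by gcongr
  refine lt_of_le_of_lt (pv_le (C := ENNReal.ofReal (2 * D ^ p)) fun n t hm hT => ?_) ENNReal.ofReal_lt_top
  calc ∑ i ∈ Finset.range n, (ENNReal.ofReal |f (t (i + 1)) - f (t i)|) ^ p
      ≤ ∑ i ∈ Finset.range n, ENNReal.ofReal (2 * D ^ p * (t (i+1) - t i)) := by
        refine Finset.sum_le_sum fun i _ => ?_
        rw [ENNReal.ofReal_rpow_of_nonneg (abs_nonneg _) hp.le]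
        exact ENNReal.ofReal_le_ofReal (key _ _ (hm (Nat.le_succ i)) (hT _))
    _ = ENNReal.ofReal (∑ i ∈ Finset.range n, 2 * D ^ p * ((t (i+1) : ℝ) - t i)) := by
        rw [ENNReal.ofReal_sum_of_nonneg]
        intro i _
        have : (t i : ℝ) ≤ t (i+1) := hm (Nat.le_succ i)
        have : 0 ≤ (t (i+1) : ℝ) - t i := by linarith
        positivity
    _ ≤ _ := by
        apply ENNReal.ofReal_le_ofReal
        rw [← Finset.mul_sum, Finset.sum_range_sub (fun i => (t i : ℝ))]
        have h1 : (t n : ℝ) ≤ 1 := hT n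
        have h0 : 0 ≤ (t 0 : ℝ) := (t 0).coe_nonneg
        have : 0 ≤ 2 * D ^ p := by positivity
        nlinarith

section
variable {Ω : Type*} {mΩ : MeasurableSpace Ω} {P : Measure Ω} {X : ℝ≥0 → Ω → ℝ}

lemma lintegral_incr (hX : IsPreBrownianReal X P) (N m k : ℕ) :
    ∫⁻ ω, ENNReal.ofReal |X (((k + 1 : ℕ) : ℝ≥0) / 2^m) ω - X ((k : ℝ≥0) / 2^m) ω| ^ N ∂P
      = ENNReal.ofReal (√(1/2) ^ N) ^ m * ∫⁻ x, ENNReal.ofReal |x| ^ N ∂(gaussianReal 0 1) := by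
  have h := hX.hasLaw_sub (((k + 1 : ℕ) : ℝ≥0) / 2^m) ((k : ℝ≥0) / 2^m)
  have h2 := h.lintegral_comp (f := fun x => ENNReal.ofReal |x| ^ N) (by fun_prop)
  simp only [Pi.sub_apply] at h2
  rw [h2]
  have e : gaussianReal 0 (nndist ((((k + 1 : ℕ) : ℝ≥0) / 2^m : ℝ≥0) : ℝ) (((k : ℝ≥0) / 2^m : ℝ≥0) : ℝ))
      = (gaussianReal 0 1).map (fun x => √(1/2) ^ m * x) := by
    rw [gaussianReal_map_const_mul]
    congr 1
    · simp
    · ext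
      rw [coe_nndist, Real.dist_eq]
      push_cast
      rw [← sub_div, add_sub_cancel_left, abs_of_nonneg (by positivity), ← pow_mul, mul_comm m 2, pow_mul,
        Real.sq_sqrt (by norm_num)]
      simp
  refine (congrArg (fun μ : Measure ℝ => ∫⁻ x, ENNReal.ofReal |x| ^ N ∂μ) e).trans ?_
  rw [lintegral_map (by fun_prop) (by fun_prop), ← lintegral_const_mul _ (by fun_prop)]
  congr 1 with x
  rw [abs_mul, ENNReal.ofReal_mul (by positivity), mul_pow, abs_of_nonneg (by positivity),
    ← ENNReal.ofReal_pow (by positivity), ← ENNReal.ofReal_pow (by positivity),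
    ← ENNReal.ofReal_pow (by positivity), ← pow_mul, ← pow_mul, mul_comm m]

lemma pv_finite (hX : IsPreBrownianReal X P) (hm : ∀ t, Measurable (X t))
    (hc : ∀ ω, Continuous fun t => X t ω) {p : ℝ} (hp : 2 < p) :
    ∀ᵐ ω ∂P, pv p (fun t => X t ω) 1 < ⊤ := by
  set r : ℝ := (1/2)^(1/p) with hrdef
  have hr : 0 < r := by positivity
  have hr1 : r < 1 := Real.rpow_lt_one (by norm_num) (by norm_num) (by positivity)
  have hrp : r ^ p = 1/2 := by
    rw [hrdef, ← Real.rpow_mul (by norm_num), one_div_mul_cancel (by linarith), Real.rpow_one]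
  have hsr : √(1/2) / r < 1 := by
    rw [div_lt_one hr, Real.sqrt_eq_rpow]
    apply Real.rpow_lt_rpow_of_exponent_gt (by norm_num) (by norm_num)
    exact one_div_lt_one_div_of_lt (by norm_num) hp
  obtain ⟨N, hN⟩ := exists_pow_lt_of_lt_one (show (0:ℝ) < 1/2 by norm_num) hsr
  have hN0 : N ≠ 0 := by rintro rfl; norm_num at hN
  set M := ∫⁻ x, ENNReal.ofReal |x| ^ N ∂(gaussianReal 0 1) with hM
  have hMtop : M < ⊤ := by
    have := (memLp_id_gaussianReal (μ := 0) (v := 1) (N : ℝ≥0))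
    have := lintegral_rpow_enorm_lt_top_of_eLpNorm_lt_top (by simpa using hN0) (by simp) this.2
    simpa [hM, Real.enorm_eq_ofReal_abs] using this
  set H : Ω → ℝ≥0∞ := fun ω => ∑' m : ℕ, ∑ k ∈ Finset.range (2^m),
    ENNReal.ofReal (r⁻¹ ^ N) ^ m *
      ENNReal.ofReal |X (((k + 1 : ℕ) : ℝ≥0) / 2^m) ω - X ((k : ℝ≥0) / 2^m) ω| ^ N with hH
  have hmeas : ∀ m k : ℕ, Measurable fun ω => ENNReal.ofReal (r⁻¹ ^ N) ^ m *
      ENNReal.ofReal |X (((k + 1 : ℕ) : ℝ≥0) / 2^m) ω - X ((k : ℝ≥0) / 2^m) ω| ^ N := by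
    intro m k
    have := (hm (((k + 1 : ℕ) : ℝ≥0) / 2^m)).sub (hm ((k : ℝ≥0) / 2^m))
    exact ((measurable_norm.comp this).ennreal_ofReal.pow_const _).const_mul _
  have hmeas' : ∀ m k : ℕ, Measurable fun ω => 
      ENNReal.ofReal |X (((k + 1 : ℕ) : ℝ≥0) / 2^m) ω - X ((k : ℝ≥0) / 2^m) ω| ^ N := by
    intro m k
    have := (hm (((k + 1 : ℕ) : ℝ≥0) / 2^m)).sub (hm ((k : ℝ≥0) / 2^m))
    exact ((measurable_norm.comp this).ennreal_ofReal.pow_const _)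
  have hHint : ∫⁻ ω, H ω ∂P < ⊤ := by
    rw [hH, lintegral_tsum (fun m => (Finset.measurable_sum _ fun k _ => hmeas m k).aemeasurable)]
    have : ∀ m : ℕ, ∫⁻ ω, ∑ k ∈ Finset.range (2^m), ENNReal.ofReal (r⁻¹ ^ N) ^ m *
      ENNReal.ofReal |X (((k + 1 : ℕ) : ℝ≥0) / 2^m) ω - X ((k : ℝ≥0) / 2^m) ω| ^ N ∂P
      = (ENNReal.ofReal (2 * (√(1/2) / r)^N)) ^ m * M := by
      intro m
      rw [lintegral_finsetSum _ (fun k _ => hmeas m k)]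
      simp_rw [lintegral_const_mul _ (hmeas' m _), lintegral_incr hX N m]
      rw [Finset.sum_const, Finset.card_range, nsmul_eq_mul, ENNReal.ofReal_mul (by norm_num), div_eq_mul_inv (√(1/2)) r, mul_pow (√(1/2)),
        ENNReal.ofReal_mul (by positivity)]
      simp only [mul_pow]
      push_cast
      simp
      ring
    simp_rw [this]
    rw [ENNReal.tsum_mul_right, ENNReal.tsum_geometric]
    refine ENNReal.mul_lt_top ?_ hMtop
    rw [ENNReal.inv_lt_top, tsub_pos_iff_lt, ENNReal.ofReal_lt_one]
    linarith
  filter_upwards [ae_lt_top (Measurable.tsum fun m => (Finset.measurable_sum _ fun k _ => hmeas m k)) hHint.ne] with ω hω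
  refine pv_finite_of_dyad (hc ω) (by linarith) hr hr1 hrp (K := (H ω).toReal ^ (1/(N:ℝ))) (by positivity) ?_
  intro m k hk
  have h1 : ENNReal.ofReal (r⁻¹ ^ N) ^ m *
      ENNReal.ofReal |X (((k + 1 : ℕ) : ℝ≥0) / 2^m) ω - X ((k : ℝ≥0) / 2^m) ω| ^ N ≤ H ω := by
    refine le_trans ?_ (ENNReal.le_tsum m)
    exact Finset.single_le_sum (f := fun k : ℕ => ENNReal.ofReal (r⁻¹ ^ N) ^ m *
      ENNReal.ofReal |X (((k + 1 : ℕ) : ℝ≥0) / 2^m) ω - X ((k : ℝ≥0) / 2^m) ω| ^ N) (fun _ _ => zero_le) (by simpa using hk)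
  have h2 := ENNReal.toReal_mono hω.ne h1
  set d := |X (((k + 1 : ℕ) : ℝ≥0) / 2^m) ω - X ((k : ℝ≥0) / 2^m) ω| with hd
  have hd0 : 0 ≤ d := abs_nonneg _
  rw [ENNReal.toReal_mul, ENNReal.toReal_pow, ENNReal.toReal_pow, ENNReal.toReal_ofReal (by positivity),
    ENNReal.toReal_ofReal hd0] at h2
  have h3 : (d / r ^ m) ^ N ≤ (H ω).toReal := by
    refine le_trans (le_of_eq ?_) h2
    rw [div_pow, ← pow_mul, ← pow_mul, inv_pow, mul_comm m]; field_simp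
  have h4 : d / r ^ m ≤ (H ω).toReal ^ (1/(N:ℝ)) := by
    have := Real.rpow_le_rpow (by positivity) h3 (show 0 ≤ 1/(N:ℝ) by positivity)
    rwa [one_div, Real.pow_rpow_inv_natCast (by positivity) hN0, ← one_div] at this
  rwa [div_le_iff₀ (by positivity)] at h4
end


section
variable {Ω : Type*} {mΩ : MeasurableSpace Ω} {P : Measure Ω} [IsProbabilityMeasure P]

lemma preBrownian_of_hyp (B : ℝ → Ω → ℝ)
    (hmeas : ∀ t : ℝ, Measurable (B t))
    (hgauss : ∀ (n : ℕ) (t c : Fin n → ℝ), (∀ i, 0 ≤ t i) →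
      ∃ v : ℝ≥0, P.map (fun ω => ∑ i, c i * B (t i) ω) = gaussianReal 0 v)
    (hcov : ∀ s t : ℝ, 0 ≤ s → 0 ≤ t → ∫ ω, B s ω * B t ω ∂P = min s t) :
    IsPreBrownianReal (fun (t : ℝ≥0) ω => B t ω) P := by
  have hmean : ∀ t : ℝ≥0, ∃ v : ℝ≥0, P.map (B t) = gaussianReal 0 v := by
    intro t
    simpa using hgauss 1 (fun _ => t) (fun _ => 1) (fun _ => t.2)
  have hlaw : ∀ t : ℝ≥0, ∃ v : ℝ≥0, HasLaw (B t) (gaussianReal 0 v) P := fun t => by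
    obtain ⟨v, hv⟩ := hmean t
    exact ⟨v, (hmeas t).aemeasurable, hv⟩
  have hmean0 : ∀ t : ℝ≥0, P[B t] = 0 := fun t => by
    obtain ⟨v, hv⟩ := hlaw t
    rw [hv.integral_eq, integral_id_gaussianReal]
  apply IsGaussianProcess.isPreBrownianReal_of_covariance
  · refine ⟨fun I => ⟨?_⟩⟩
    apply isGaussian_of_map_eq_gaussianReal
    intro L
    let e := I.equivFin.symm
    obtain ⟨v, hv⟩ := hgauss I.card (fun i => ((e i : ℝ≥0) : ℝ)) (fun i => L (Pi.single (e i) 1))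
      (fun i => NNReal.coe_nonneg _)
    refine ⟨0, v, ?_⟩
    have hmm : Measurable (fun ω => I.restrict fun t : ℝ≥0 => B t ω) :=
      measurable_pi_lambda _ fun i => hmeas _
    rw [Measure.map_map (by fun_prop) hmm, ← hv]
    congr 1
    ext ω
    simp only [Function.comp_apply]
    conv_lhs => rw [← Finset.univ_sum_single (I.restrict fun t : ℝ≥0 => B t ω)]
    rw [map_sum, ← e.sum_comp]
    refine Finset.sum_congr rfl fun i _ => ?_
    have : (Pi.single (e i) (I.restrict (fun t : ℝ≥0 => B t ω) (e i)) : I → ℝ) = (B (e i : ℝ≥0) ω) • (Pi.single (e i) 1 : I → ℝ) := by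
      rw [← Pi.single_smul]; simp
    rw [this, map_smul, smul_eq_mul, mul_comm]
  · exact hmean0
  · intro s t hst
    have hL : ∀ t : ℝ≥0, MemLp (B t) 2 P := fun t => by
      obtain ⟨v, hv⟩ := hlaw t
      exact hv.hasGaussianLaw.memLp_two
    rw [covariance_eq_sub (hL s) (hL t)]
    change (∫ ω, B s ω * B t ω ∂P) - (∫ ω, B s ω ∂P) * _ = _
    rw [show ∫ ω, B s ω ∂P = 0 from hmean0 s, hcov s t s.2 t.2]
    simpa using hst

variable {X Y : ℝ≥0 → Ω → ℝ}

lemma process_law (hX : IsPreBrownianReal X P) (hY : IsPreBrownianReal Y P) 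
    (mX : ∀ t, Measurable (X t)) (mY : ∀ t, Measurable (Y t)) :
    P.map (fun ω t => X t ω) = P.map (fun ω t => Y t ω) := by
  rw [map_eq_iff_forall_finset_map_restrict_eq (measurable_pi_lambda _ mX).aemeasurable
    (measurable_pi_lambda _ mY).aemeasurable]
  intro I
  rw [(hX.hasLaw I).map_eq, (hY.hasLaw I).map_eq]

lemma ident_pv (hX : IsPreBrownianReal X P) (hY : IsPreBrownianReal Y P) 
    (mX : ∀ t, Measurable (X t)) (mY : ∀ t, Measurable (Y t))
    (cX : ∀ ω, Continuous fun t => X t ω) (cY : ∀ ω, Continuous fun t => Y t ω)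
    {p : ℝ} (hp : 0 < p) (a T : ℝ≥0) :
    IdentDistrib (fun ω => (X a ω, pv p (fun t => X t ω) T)) (fun ω => (Y a ω, pv p (fun t => Y t ω) T)) P P := by
  have h : IdentDistrib (fun ω t => X t ω) (fun ω t => Y t ω) P P :=
    ⟨(measurable_pi_lambda _ mX).aemeasurable, (measurable_pi_lambda _ mY).aemeasurable,
      process_law hX hY mX mY⟩
  have hm : Measurable (fun f : ℝ≥0 → ℝ => (f a, ⨆ (n : ℕ) (q : {q : Fin (n + 1) → ℚ≥0 // Monotone q ∧ ∀ i, q i ≤ 1}),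
      ∑ i : Fin n, (ENNReal.ofReal |f (T * (q.1 i.succ : ℝ≥0)) - f (T * (q.1 i.castSucc : ℝ≥0))|) ^ p)) := by
    refine (measurable_pi_apply a).prodMk ?_
    refine Measurable.iSup fun n => Measurable.iSup fun q => ?_
    refine Finset.measurable_sum _ fun i _ => ?_
    apply Measurable.pow_const
    apply Measurable.ennreal_ofReal
    have hh : ∀ t : ℝ≥0, Measurable fun f : ℝ≥0 → ℝ => f t := fun t => measurable_pi_apply t
    exact ((hh _).sub (hh _)).abs
  have := h.comp hm
  simpa only [Function.comp_def, pv_eq_countable hp (cX _), pv_eq_countable hp (cY _)] using this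

end


/-- continuous measurable Brownian motion -/
structure IsBM {Ω : Type*} [MeasurableSpace Ω] (X : ℝ≥0 → Ω → ℝ) (P : Measure Ω) : Prop where
  pre : IsPreBrownianReal X P
  meas : ∀ t, Measurable (X t)
  cont : ∀ ω, Continuous fun t => X t ω

set_option linter.unusedSectionVars false
set_option linter.unusedVariables false
section
variable {Ω : Type*} [MeasurableSpace Ω] {P : Measure Ω} [IsProbabilityMeasure P]
variable {X Y : ℝ≥0 → Ω → ℝ} {p : ℝ}

lemma IsBM.shift' (hX : IsBM X P) (s : ℝ≥0) : IsBM (fun t ω => X (s + t) ω - X s ω) P where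
  pre := hX.pre.shift s
  meas t := (hX.meas _).sub (hX.meas _)
  cont ω := ((hX.cont ω).comp (continuous_const.add continuous_id)).sub continuous_const

lemma IsBM.scale' (hX : IsBM X P) {c : ℝ≥0} (hc : c ≠ 0) :
    IsBM (fun t ω => (√(c:ℝ))⁻¹ * X (c * t) ω) P where
  pre := hX.pre.smul hc
  meas t := (hX.meas _).const_mul _
  cont ω := continuous_const.mul ((hX.cont ω).comp (continuous_const.mul continuous_id))

lemma IsBM.measurable_pv (hX : IsBM X P) (hp : 0 < p) (T : ℝ≥0) :
    Measurable fun ω => pv p (fun t => X t ω) T :=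
  _root_.measurable_pv hp hX.cont T fun t _ => hX.meas t

lemma IsBM.ident (hX : IsBM X P) (hY : IsBM Y P) (hp : 0 < p) (a T : ℝ≥0) :
    IdentDistrib (fun ω => (X a ω, pv p (fun t => X t ω) T))
      (fun ω => (Y a ω, pv p (fun t => Y t ω) T)) P P :=
  ident_pv hX.pre hY.pre hX.meas hY.meas hX.cont hY.cont hp a T

lemma IsBM.ident' (hX : IsBM X P) (hY : IsBM Y P) (hp : 0 < p) (T : ℝ≥0) :
    IdentDistrib (fun ω => pv p (fun t => X t ω) T) (fun ω => pv p (fun t => Y t ω) T) P P :=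
  (hX.ident hY hp 0 T).comp measurable_snd

/-- scaling -/
lemma IsBM.ident_scale (hX : IsBM X P) (hp : 0 < p) {c : ℝ≥0} (hc : c ≠ 0) :
    IdentDistrib (fun ω => pv p (fun t => X t ω) c)
      (fun ω => (ENNReal.ofReal (√(c:ℝ))) ^ p * pv p (fun t => X t ω) 1) P P := by
  have hs : 0 < √(c:ℝ) := Real.sqrt_pos.2 (NNReal.coe_pos.2 (pos_iff_ne_zero.2 hc))
  have h := (hX.scale' hc).ident' hX hp 1
  have h2 := h.comp (u := fun x => (ENNReal.ofReal (√(c:ℝ))) ^ p * x) (by fun_prop)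
  simp only [Function.comp_def] at h2
  convert h2 using 2 with ω
  rw [pv_scale hp (fun t => X t ω) (inv_ne_zero hs.ne') hc, mul_one, ← mul_assoc,
    ← ENNReal.mul_rpow_of_nonneg _ _ hp.le, ← ENNReal.ofReal_mul hs.le, abs_of_pos (by positivity),
    mul_inv_cancel₀ hs.ne']
  simp

lemma IsBM.finite (hX : IsBM X P) (hp : 2 < p) (T : ℝ≥0) :
    ∀ᵐ ω ∂P, pv p (fun t => X t ω) T < ⊤ := by
  have h1 : ∀ᵐ ω ∂P, pv p (fun t => X t ω) 1 < ⊤ := pv_finite hX.pre hX.meas hX.cont hp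
  have key : ∀ c : ℝ≥0, c ≠ 0 → ∀ᵐ ω ∂P, pv p (fun t => X t ω) c < ⊤ := by
    intro c hc
    refine (hX.ident_scale (by linarith) hc).symm.ae_mem_snd (t := Iio ⊤) measurableSet_Iio ?_
    filter_upwards [h1] with ω hω
    exact ENNReal.mul_lt_top (ENNReal.rpow_lt_top_of_nonneg (by linarith) ENNReal.ofReal_ne_top) hω
  filter_upwards [key (T+1) (by positivity)] with ω hω
  exact (pv_mono p _ (le_add_of_nonneg_right zero_le)).trans_lt hω

/-- Laplace functional -/
noncomputable def Lap (P : Measure Ω) (X : ℝ≥0 → Ω → ℝ) (p : ℝ) (T : ℝ≥0) : ℝ :=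
  ∫ ω, Real.exp (-(pv p (fun t => X t ω) T).toReal) ∂P

lemma IsBM.integrable (hX : IsBM X P) (hp : 2 < p) (T : ℝ≥0) :
    Integrable (fun ω => Real.exp (-(pv p (fun t => X t ω) T).toReal)) P := by
  simpa using integrable_exp_neg (P := P) (l := 1) (hX.measurable_pv (p := p) (by linarith) T).ennreal_toReal
    (fun ω => ENNReal.toReal_nonneg) zero_le_one

lemma Lap_congr (hX : IsBM X P) (hY : IsBM Y P) (hp : 0 < p) (T : ℝ≥0) : Lap P X p T = Lap P Y p T := by
  have := (hX.ident' hY hp T).comp (u := fun x => Real.exp (-x.toReal))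
    (ENNReal.measurable_toReal.neg.exp)
  exact this.integral_eq

lemma Lap_scale (hX : IsBM X P) (hp : 2 < p) {c : ℝ≥0} (hc : c ≠ 0) :
    Lap P X p c = ∫ ω, Real.exp (-((c:ℝ) ^ (p/2) * (pv p (fun t => X t ω) 1).toReal)) ∂P := by
  have := (hX.ident_scale (p := p) (by linarith) hc).comp (u := fun x => Real.exp (-x.toReal))
    (ENNReal.measurable_toReal.neg.exp)
  refine this.integral_eq.trans ?_
  congr 1 with ω
  simp only [Function.comp_apply, ENNReal.toReal_mul]
  rw [← ENNReal.toReal_rpow, ENNReal.toReal_ofReal (Real.sqrt_nonneg _), Real.sqrt_eq_rpow,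
    ← Real.rpow_mul c.coe_nonneg]
  ring_nf

lemma Lap_pos (hX : IsBM X P) (hp : 2 < p) (T : ℝ≥0) : 0 < Lap P X p T :=
  integral_exp_pos (hX.integrable hp T)

lemma Lap_anti (hX : IsBM X P) (hp : 2 < p) {S T : ℝ≥0} (h : S ≤ T) : Lap P X p T ≤ Lap P X p S := by
  refine integral_mono_ae (hX.integrable hp T) (hX.integrable hp S) ?_
  filter_upwards [hX.finite hp T] with ω hω
  gcongr
  · exact hω.ne
  · exact pv_mono p _ h

lemma IsBM.indep (hX : IsBM X P) (s : ℝ≥0) {E F : Type*} [MeasurableSpace E] [MeasurableSpace F]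
    {u : Ω → E} {v : Ω → F}
    (hu : Measurable[MeasurableSpace.comap (fun ω (t : Set.Iic s) => X t ω) inferInstance] u)
    (hv : Measurable[MeasurableSpace.comap (fun ω t => X (s + t) ω - X s ω) inferInstance] v) :
    IndepFun u v P := by
  have h := (hX.pre.indepFun_shift s).symm
  rw [IndepFun_iff_Indep] at *
  exact indep_of_indep_of_le_left (indep_of_indep_of_le_right h hv.comap_le) hu.comap_le

lemma meas_past (X : ℝ≥0 → Ω → ℝ) {s t : ℝ≥0} (h : t ≤ s) :
    Measurable[MeasurableSpace.comap (fun ω (t : Set.Iic s) => X t ω) inferInstance] (X t) := by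
  have := (measurable_pi_apply (⟨t, h⟩ : Set.Iic s)).comp
    (comap_measurable (fun ω (t : Set.Iic s) => X t ω))
  exact this

lemma meas_future (X : ℝ≥0 → Ω → ℝ) (s t : ℝ≥0) :
    Measurable[MeasurableSpace.comap (fun ω t => X (s + t) ω - X s ω) inferInstance]
      (fun ω => X (s + t) ω - X s ω) := by
  have := (measurable_pi_apply t).comp
    (comap_measurable (fun ω t => X (s + t) ω - X s ω))
  exact this

lemma Lap_submul (hX : IsBM X P) (hp : 2 < p) (S T : ℝ≥0) :
    Lap P X p (S + T) ≤ Lap P X p S * Lap P X p T := by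
  have hp0 : 0 < p := by linarith
  rw [Lap_congr hX (hX.shift' S) hp0 T]
  have hind : IndepFun (fun ω => Real.exp (-(pv p (fun t => X t ω) S).toReal))
      (fun ω => Real.exp (-(pv p (fun t => X (S + t) ω - X S ω) T).toReal)) P := by
    apply hX.indep S
    · exact (_root_.measurable_pv hp0 hX.cont S fun t ht => meas_past X ht).ennreal_toReal.neg.exp
    · exact (_root_.measurable_pv hp0 (hX.shift' S).cont T fun t ht => meas_future X S t).ennreal_toReal.neg.exp
  unfold Lap
  have := hind.integral_fun_mul_eq_mul_integral (hX.integrable hp S).1 ((hX.shift' S).integrable hp T).1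
  rw [← this]
  refine integral_mono_ae (hX.integrable hp _) (hind.integrable_mul (hX.integrable hp S) ((hX.shift' S).integrable hp T)) ?_
  filter_upwards [hX.finite hp (S+T), hX.finite hp S, (hX.shift' S).finite hp T] with ω h1 h2 h3
  rw [← Real.exp_add, ← neg_add, ← ENNReal.toReal_add h2.ne h3.ne]
  gcongr
  · exact h1.ne
  · exact pv_superadd p _ S T

lemma gauss_pos (hX : IsBM X P) {a b : ℝ} (hab : a < b) : 0 < P {ω | X 1 ω ∈ Icc a b} := by
  have h := hX.pre.hasLaw_eval 1
  have e : P {ω | X 1 ω ∈ Icc a b} = gaussianReal 0 1 (Icc a b) := by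
    rw [← h.map_eq, Measure.map_apply (hX.meas 1) measurableSet_Icc]; rfl
  rw [e, pos_iff_ne_zero]
  intro h0
  have := gaussianReal_absolutelyContinuous' 0 one_ne_zero h0
  simp at this
  linarith

lemma Lap_one_lt (hX : IsBM X P) (hp : 2 < p) : Lap P X p 1 < 1 := by
  have hp0 : 0 < p := by linarith
  by_contra hcon
  push Not at hcon
  have hi := hX.integrable hp 1
  have h0 : ∫ ω, (1 - Real.exp (-(pv p (fun t => X t ω) 1).toReal)) ∂P ≤ 0 := by
    rw [integral_sub (integrable_const _) hi]
    simp only [integral_const, probReal_univ, smul_eq_mul, mul_one]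
    unfold Lap at hcon
    linarith
  have hnn : ∀ ω, 0 ≤ 1 - Real.exp (-(pv p (fun t => X t ω) 1).toReal) := fun ω => by
    have : Real.exp (-(pv p (fun t => X t ω) 1).toReal) ≤ 1 := 
      Real.exp_le_one_iff.2 (neg_nonpos.2 ENNReal.toReal_nonneg)
    linarith
  have h1 := (integral_eq_zero_iff_of_nonneg hnn ((integrable_const _).sub hi)).1
    (le_antisymm h0 (integral_nonneg hnn))
  have h2 : ∀ᵐ ω ∂P, ¬ (X 1 ω ∈ Icc 1 2) := by
    filter_upwards [h1, hX.finite hp 1, hX.pre.eval_zero_ae_eq_zero] with ω h1 h2 h3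
    simp only [Pi.zero_apply] at h1
    have h4 : Real.exp (-(pv p (fun t => X t ω) 1).toReal) = 1 := by linarith
    rw [Real.exp_eq_one_iff, neg_eq_zero, ENNReal.toReal_eq_zero_iff] at h4
    have h5 : pv p (fun t => X t ω) 1 = 0 := h4.resolve_right h2.ne
    have h6 := pv_ge_incr p (fun t => X t ω) (s := 0) (t := 1) (T := 1) zero_le_one le_rfl
    rw [h5, h3, le_zero_iff, ENNReal.rpow_eq_zero_iff_of_pos hp0, ENNReal.ofReal_eq_zero] at h6
    have := le_abs_self (X 1 ω - 0)
    intro hh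
    have := hh.1
    linarith
  have := gauss_pos hX (show (1:ℝ) < 2 by norm_num)
  rw [ae_iff] at h2
  simp only [not_not] at h2
  rw [h2] at this
  exact lt_irrefl _ this

end


set_option linter.unusedSectionVars false
set_option linter.unusedVariables false

lemma incr_le_of_pv {p : ℝ} (hp : 0 < p) {f : ℝ≥0 → ℝ} {M : ℕ} (h : pv p f 1 ≤ (M : ℝ≥0∞))
    {s t : ℝ≥0} (hst : s ≤ t) (ht : t ≤ 1) : |f t - f s| ≤ (M : ℝ) ^ (1/p) := by
  have h1 := (pv_ge_incr p f hst ht).trans h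
  rw [ENNReal.ofReal_rpow_of_nonneg (abs_nonneg _) hp.le, ← ENNReal.ofReal_natCast,
    ENNReal.ofReal_le_ofReal_iff (by positivity)] at h1
  have h2 := Real.rpow_le_rpow (by positivity) h1 (show 0 ≤ 1/p by positivity)
  rwa [← Real.rpow_mul (abs_nonneg _), mul_one_div_cancel hp.ne', Real.rpow_one] at h2

lemma pv_block {p : ℝ} (hp : 0 < p) {f : ℝ≥0 → ℝ} {M n : ℕ}
    (h1 : ∀ k : ℕ, k ≤ n → |f k| ≤ 1)
    (h2 : ∀ k : ℕ, k < n → pv p (fun t => f (k + t) - f k) 1 ≤ (M : ℝ≥0∞)) :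
    pv p f n ≤ ENNReal.ofReal (n * (M + (2 + 2 * (M:ℝ)^(1/p))^p)) := by
  set m := (M:ℝ)^(1/p) with hm
  have hm0 : 0 ≤ m := by positivity
  have hb : ∀ s : ℝ≥0, s ≤ n → |f s| ≤ 1 + m := by
    intro s hs
    rcases hs.eq_or_lt with rfl | hs
    · have := h1 n le_rfl; linarith
    · have hk : ⌊s⌋₊ < n := (Nat.floor_lt zero_le).2 hs
      have a1 : ((⌊s⌋₊ : ℕ) : ℝ≥0) ≤ s := Nat.floor_le zero_le
      have a2 : s - (⌊s⌋₊ : ℝ≥0) ≤ 1 := by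
        rw [tsub_le_iff_left]; exact (Nat.lt_floor_add_one s).le
      have a3 := incr_le_of_pv hp (h2 _ hk) (s := 0) (t := s - (⌊s⌋₊ : ℝ≥0)) zero_le a2
      rw [add_tsub_cancel_of_le a1] at a3
      simp only [add_zero, sub_self, sub_zero] at a3
      have a4 := h1 _ hk.le
      rw [abs_le] at *
      constructor <;> linarith
  have key : ∀ j : ℕ, j ≤ n → pv p f j ≤ ENNReal.ofReal (j * (M + (2 + 2 * m)^p)) := by
    intro j
    induction j with
    | zero =>
      intro _
      apply pv_le
      intro k t ht hT
      have : ∀ i, t i = 0 := fun i => le_antisymm (by simpa using hT i) zero_le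
      simp [this, hp]
    | succ j ih =>
      intro hj
      have i1 := ih (by omega)
      have i2 := pv_subadd hp f j 1 (2 + 2 * m) (by
        intro s t hs ht
        have b1 := hb s (hs.trans (by exact_mod_cast (by omega : j ≤ n)))
        have b2 := hb t (ht.trans (by exact_mod_cast hj))
        rw [abs_le] at *
        constructor <;> linarith)
      push_cast
      refine i2.trans ?_
      have i3 := h2 j (by omega)
      rw [ENNReal.ofReal_rpow_of_nonneg (by positivity) hp.le]
      rw [← ENNReal.ofReal_natCast] at i3
      calc _ ≤ ENNReal.ofReal (j * (M + (2 + 2 * m)^p)) + ENNReal.ofReal M + ENNReal.ofReal ((2 + 2 * m)^p) := by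
            gcongr
        _ = _ := by
            rw [← ENNReal.ofReal_add (by positivity) (by positivity), ← ENNReal.ofReal_add (by positivity) (by positivity)]
            congr 1; ring
  exact key n le_rfl

section
variable {Ω : Type*} [MeasurableSpace Ω] {P : Measure Ω} [IsProbabilityMeasure P]
variable {X Y : ℝ≥0 → Ω → ℝ} {p : ℝ}

lemma exists_M (hX : IsBM X P) (hp : 2 < p) {a b : ℝ} (hab : a < b) :
    ∃ M : ℕ, 0 < P {ω | X 1 ω ∈ Icc a b ∧ pv p (fun t => X t ω) 1 ≤ (M : ℝ≥0∞)} := by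
  by_contra! hcon
  have h0 : P (⋃ M : ℕ, {ω | X 1 ω ∈ Icc a b ∧ pv p (fun t => X t ω) 1 ≤ (M : ℝ≥0∞)}) = 0 :=
    measure_iUnion_null fun M => le_antisymm (hcon M) zero_le
  have h1 := gauss_pos hX hab
  refine h1.ne' ?_
  refine measure_mono_null_ae ?_ h0
  filter_upwards [hX.finite hp 1] with ω hω hmem
  obtain ⟨M, hM⟩ := ENNReal.exists_nat_gt hω.ne
  exact mem_iUnion.2 ⟨M, hmem, hM.le⟩

/-- good events -/
def goodE (X : ℝ≥0 → Ω → ℝ) (p : ℝ) (M n : ℕ) : Set Ω :=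
  {ω | (∀ k : ℕ, k ≤ n → |X k ω| ≤ 1) ∧
    ∀ k : ℕ, k < n → pv p (fun t => X (k + t) ω - X k ω) 1 ≤ (M : ℝ≥0∞)}

lemma meas_goodE (hX : IsBM X P) (hp : 0 < p) (M n : ℕ) :
    MeasurableSet[MeasurableSpace.comap (fun ω (t : Set.Iic (n:ℝ≥0)) => X t ω) inferInstance]
      (goodE X p M n) := by
  have : goodE X p M n = (⋂ (k : ℕ) (_ : k ≤ n), {ω | |X k ω| ≤ 1}) ∩
      ⋂ (k : ℕ) (_ : k < n), {ω | pv p (fun t => X (k + t) ω - X k ω) 1 ≤ (M : ℝ≥0∞)} := by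
    ext ω; simp [goodE]
  rw [this]
  refine MeasurableSet.inter ?_ ?_
  · refine MeasurableSet.iInter fun k => MeasurableSet.iInter fun hk => ?_
    have hkn : (k:ℝ≥0) ≤ n := by exact_mod_cast hk
    have hm := meas_past X hkn
    have hS : MeasurableSet {x : ℝ | |x| ≤ 1} := measurableSet_le measurable_id.abs measurable_const
    exact hm hS
  · refine MeasurableSet.iInter fun k => MeasurableSet.iInter fun hk => ?_
    have hkn : (k:ℝ≥0) + 1 ≤ n := by exact_mod_cast hk
    have hm := measurable_pv (m := MeasurableSpace.comap (fun ω (t : Set.Iic (n:ℝ≥0)) => X t ω) inferInstance)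
      hp (hX.shift' k).cont 1 fun t ht => (meas_past X ((add_le_add_right ht (k:ℝ≥0)).trans hkn)).sub
      (meas_past X (le_self_add.trans hkn))
    exact hm (measurableSet_Iic (a := (M : ℝ≥0∞)))

lemma goodE_step (hX : IsBM X P) (hp : 0 < p) (M n : ℕ) (q : ℝ≥0∞)
    (hq1 : q ≤ P {ω | X 1 ω ∈ Icc (-1) 0 ∧ pv p (fun t => X t ω) 1 ≤ (M : ℝ≥0∞)})
    (hq2 : q ≤ P {ω | X 1 ω ∈ Icc 0 1 ∧ pv p (fun t => X t ω) 1 ≤ (M : ℝ≥0∞)}) :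
    q * P (goodE X p M n) ≤ P (goodE X p M (n+1)) := by
  have hpast : MeasurableSpace.comap (fun ω (t : Set.Iic (n:ℝ≥0)) => X t ω) inferInstance ≤ ‹MeasurableSpace Ω› := by
    rw [← measurable_iff_comap_le]
    exact measurable_pi_lambda _ fun t => hX.meas t
  have hfut : MeasurableSpace.comap (fun ω t => X (n + t) ω - X n ω) inferInstance ≤ ‹MeasurableSpace Ω› := by
    rw [← measurable_iff_comap_le]
    exact measurable_pi_lambda _ fun t => (hX.shift' n).meas t
  set F : Set ℝ → Set Ω := fun A => {ω | X (n + 1) ω - X n ω ∈ A ∧ pv p (fun t => X (n + t) ω - X n ω) 1 ≤ (M : ℝ≥0∞)} with hF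
  have hFm : ∀ A, MeasurableSet A → 
      MeasurableSet[MeasurableSpace.comap (fun ω t => X (n + t) ω - X n ω) inferInstance] (F A) := by
    intro A hA
    refine MeasurableSet.inter (meas_future X n 1 hA) ?_
    exact measurableSet_le (measurable_pv hp (hX.shift' n).cont 1 fun t ht => meas_future X n t) measurable_const
  have hFP : ∀ A, MeasurableSet A → P (F A) = P {ω | X 1 ω ∈ A ∧ pv p (fun t => X t ω) 1 ≤ (M : ℝ≥0∞)} := by
    intro A hA
    have := ((hX.shift' n).ident hX hp 1 1).measure_mem_eq (s := A ×ˢ Iic (M : ℝ≥0∞)) (hA.prod measurableSet_Iic)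
    exact this
  have hI := (hX.pre.indepFun_shift n).symm
  rw [IndepFun_iff_Indep, Indep_iff] at hI
  have hG := meas_goodE hX hp M n
  have hpos : MeasurableSet[MeasurableSpace.comap (fun ω (t : Set.Iic (n:ℝ≥0)) => X t ω) inferInstance] {ω | 0 ≤ X n ω} :=
    measurableSet_le measurable_const (meas_past X le_rfl)
  have e1 := hI (goodE X p M n ∩ {ω | 0 ≤ X n ω}) (F (Icc (-1) 0)) (hG.inter hpos) (hFm _ measurableSet_Icc)
  have e2 := hI (goodE X p M n \ {ω | 0 ≤ X n ω}) (F (Icc 0 1)) (hG.diff hpos) (hFm _ measurableSet_Icc)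
  rw [hFP _ measurableSet_Icc] at e1 e2
  rw [← measure_inter_add_sdiff (goodE X p M n) (hpast _ hpos), mul_add]
  calc q * P (goodE X p M n ∩ {ω | 0 ≤ X n ω}) + q * P (goodE X p M n \ {ω | 0 ≤ X n ω})
      ≤ P (goodE X p M n ∩ {ω | 0 ≤ X n ω} ∩ F (Icc (-1) 0)) + P (goodE X p M n \ {ω | 0 ≤ X n ω} ∩ F (Icc 0 1)) := by
        rw [e1, e2, mul_comm q, mul_comm q]
        gcongr
    _ = P ((goodE X p M n ∩ {ω | 0 ≤ X n ω} ∩ F (Icc (-1) 0)) ∪ (goodE X p M n \ {ω | 0 ≤ X n ω} ∩ F (Icc 0 1))) := by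
        rw [measure_union _ ((hpast _ (hG.diff hpos)).inter (hfut _ (hFm _ measurableSet_Icc)))]
        rw [Set.disjoint_left]
        rintro ω ⟨⟨_, h⟩, _⟩ ⟨⟨_, h'⟩, _⟩
        exact h' h
    _ ≤ _ := by
        apply measure_mono
        have aux : ∀ ω, ω ∈ goodE X p M n → |X (n+1) ω| ≤ 1 →
            pv p (fun t => X (n + t) ω - X n ω) 1 ≤ (M : ℝ≥0∞) → ω ∈ goodE X p M (n+1) := by
          intro ω h1 h2 h3
          refine ⟨fun k hk => ?_, fun k hk => ?_⟩
          · rcases Nat.le_succ_iff.1 hk with hk | rfl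
            · exact h1.1 k hk
            · push_cast; exact h2
          · rcases Nat.lt_succ_iff_lt_or_eq.1 hk with hk | rfl
            · exact h1.2 k hk
            · exact h3
        rintro ω (⟨⟨h1, h2⟩, h3, h4⟩ | ⟨⟨h1, h2⟩, h3, h4⟩)
        · refine aux ω h1 ?_ h4
          have := abs_le.1 (h1.1 n le_rfl)
          simp only [mem_ofPred_eq, mem_Icc] at h2 h3
          rw [abs_le]; constructor <;> linarith
        · refine aux ω h1 ?_ h4
          have := abs_le.1 (h1.1 n le_rfl)
          simp only [mem_ofPred_eq, mem_Icc, not_le] at h2 h3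
          rw [abs_le]; constructor <;> linarith

lemma Lap_lower (hX : IsBM X P) (hp : 2 < p) : ∃ c : ℝ, 0 < c ∧ ∀ n : ℕ, c ^ n ≤ Lap P X p n := by
  have hp0 : 0 < p := by linarith
  obtain ⟨M1, hM1⟩ := exists_M hX hp (show (-1:ℝ) < 0 by norm_num)
  obtain ⟨M2, hM2⟩ := exists_M hX hp (show (0:ℝ) < 1 by norm_num)
  set M := max M1 M2
  have hq1 : 0 < P {ω | X 1 ω ∈ Icc (-1) 0 ∧ pv p (fun t => X t ω) 1 ≤ (M : ℝ≥0∞)} := by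
    refine hM1.trans_le (measure_mono fun ω h => ⟨h.1, h.2.trans ?_⟩)
    exact_mod_cast le_max_left _ _
  have hq2 : 0 < P {ω | X 1 ω ∈ Icc 0 1 ∧ pv p (fun t => X t ω) 1 ≤ (M : ℝ≥0∞)} := by
    refine hM2.trans_le (measure_mono fun ω h => ⟨h.1, h.2.trans ?_⟩)
    exact_mod_cast le_max_right _ _
  set q := min (P {ω | X 1 ω ∈ Icc (-1) 0 ∧ pv p (fun t => X t ω) 1 ≤ (M : ℝ≥0∞)})
    (P {ω | X 1 ω ∈ Icc 0 1 ∧ pv p (fun t => X t ω) 1 ≤ (M : ℝ≥0∞)}) with hq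
  have hq0 : 0 < q := lt_min hq1 hq2
  have hqt : q ≠ ⊤ := ((min_le_left _ _).trans_lt (measure_lt_top _ _)).ne
  have hE : ∀ n, q ^ n ≤ P (goodE X p M n) := by
    intro n
    induction n with
    | zero =>
      have : P (goodE X p M 0) = 1 := by
        rw [← measure_univ (μ := P)]
        refine measure_congr ?_
        filter_upwards [hX.pre.eval_zero_ae_eq_zero] with ω h0
        refine propext ⟨fun _ => trivial, fun _ => ⟨fun k hk => ?_, fun k hk => absurd hk (Nat.not_lt_zero k)⟩⟩
        obtain rfl : k = 0 := by omega
        simp [h0]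
      rw [this, pow_zero]
    | succ n ih =>
      refine le_trans ?_ (goodE_step hX hp0 M n q (min_le_left _ _) (min_le_right _ _))
      rw [pow_succ']; gcongr
  set G := (M + (2 + 2 * (M:ℝ)^(1/p))^p) with hG
  have hG0 : 0 ≤ G := by positivity
  refine ⟨q.toReal * Real.exp (-G), mul_pos (ENNReal.toReal_pos hq0.ne' hqt) (Real.exp_pos _), fun n => ?_⟩
  have hgm : MeasurableSet (goodE X p M n) := by
    have hpast : MeasurableSpace.comap (fun ω (t : Set.Iic (n:ℝ≥0)) => X t ω) inferInstance ≤ ‹MeasurableSpace Ω› := by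
      rw [← measurable_iff_comap_le]
      exact measurable_pi_lambda _ fun t => hX.meas t
    exact hpast _ (meas_goodE hX hp0 M n)
  have hr : q.toReal ^ n ≤ P.real (goodE X p M n) := by
    rw [← ENNReal.toReal_pow]
    exact ENNReal.toReal_mono (measure_ne_top _ _) (hE n)
  calc (q.toReal * Real.exp (-G)) ^ n = q.toReal ^ n * Real.exp (-(n * G)) := by
        rw [mul_pow, ← Real.exp_nat_mul]; ring_nf
    _ ≤ P.real (goodE X p M n) * Real.exp (-(n * G)) := by gcongr
    _ = ∫ ω in goodE X p M n, Real.exp (-(n * G)) ∂P := by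
        rw [setIntegral_const, smul_eq_mul]
    _ ≤ ∫ ω in goodE X p M n, Real.exp (-(pv p (fun t => X t ω) n).toReal) ∂P := by
        refine setIntegral_mono_on (integrable_const _).integrableOn (hX.integrable hp n).integrableOn hgm ?_
        intro ω hω
        gcongr
        exact ENNReal.toReal_le_of_le_ofReal (by positivity) (pv_block hp0 hω.1 hω.2)
    _ ≤ _ := setIntegral_le_integral (hX.integrable hp n) (ae_of_all _ fun ω => (Real.exp_pos _).le)

end


section
variable {Ω : Type*} [MeasurableSpace Ω] {P : Measure Ω} [IsProbabilityMeasure P]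
variable {X Y : ℝ≥0 → Ω → ℝ} {p : ℝ}

lemma Lap_fekete (hX : IsBM X P) (hp : 2 < p) :
    ∃ C : ℝ, 0 < C ∧ Tendsto (fun n : ℕ => Real.log (Lap P X p n) / n) atTop (𝓝 (-C)) := by
  obtain ⟨c, hc, hcn⟩ := Lap_lower hX hp
  have hsub : Subadditive (fun n : ℕ => Real.log (Lap P X p n)) := by
    intro m n
    simp only
    rw [← Real.log_mul (Lap_pos hX hp _).ne' (Lap_pos hX hp _).ne']
    apply Real.log_le_log (Lap_pos hX hp _)
    push_cast
    exact Lap_submul hX hp m n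
  have hbdd : BddBelow (range fun n : ℕ => Real.log (Lap P X p n) / n) := by
    refine ⟨min 0 (Real.log c), ?_⟩
    rintro _ ⟨n, rfl⟩
    rcases Nat.eq_zero_or_pos n with rfl | hn
    · simp
    · refine (min_le_right _ _).trans ?_
      simp only
      have hn' : (0:ℝ) < n := by exact_mod_cast hn
      rw [le_div_iff₀ hn', mul_comm, ← Real.log_pow]
      exact Real.log_le_log (by positivity) (hcn n)
  refine ⟨-hsub.lim, ?_, by simpa using hsub.tendsto_lim hbdd⟩
  have h1 := hsub.lim_le_div hbdd one_ne_zero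
  simp only [Nat.cast_one, div_one] at h1
  have h2 := Real.log_neg (Lap_pos hX hp 1) (Lap_one_lt hX hp)
  linarith

lemma Lap_real (hX : IsBM X P) (hp : 2 < p) {C : ℝ}
    (h : Tendsto (fun n : ℕ => Real.log (Lap P X p n) / n) atTop (𝓝 (-C))) :
    Tendsto (fun T : ℝ => Real.log (Lap P X p T.toNNReal) / T) atTop (𝓝 (-C)) := by
  have hfl : Tendsto (fun T : ℝ => ⌊T⌋₊) atTop atTop := tendsto_nat_floor_atTop
  have hq : Tendsto (fun T : ℝ => (⌊T⌋₊ : ℝ) / T) atTop (𝓝 1) := tendsto_nat_floor_div_atTop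
  have hq1 : Tendsto (fun T : ℝ => ((⌊T⌋₊ + 1 : ℕ) : ℝ) / T) atTop (𝓝 1) := by
    have : Tendsto (fun T : ℝ => (⌊T⌋₊ : ℝ) / T + 1 / T) atTop (𝓝 (1 + 0)) :=
      hq.add (tendsto_const_nhds.div_atTop tendsto_id)
    rw [add_zero] at this
    refine this.congr fun T => ?_
    push_cast; ring
  have hup : Tendsto (fun T : ℝ => Real.log (Lap P X p (⌊T⌋₊ : ℕ)) / (⌊T⌋₊ : ℝ) * ((⌊T⌋₊ : ℝ) / T)) atTop (𝓝 (-C)) := by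
    simpa using (h.comp hfl).mul hq
  have hlo : Tendsto (fun T : ℝ => Real.log (Lap P X p (⌊T⌋₊ + 1 : ℕ)) / ((⌊T⌋₊ + 1 : ℕ) : ℝ) * (((⌊T⌋₊ + 1 : ℕ) : ℝ) / T)) atTop (𝓝 (-C)) := by
    simpa using (h.comp ((tendsto_add_atTop_nat 1).comp hfl)).mul hq1
  refine tendsto_of_tendsto_of_tendsto_of_le_of_le' hlo hup ?_ ?_
  · filter_upwards [eventually_ge_atTop 1] with T hT
    have hpos : (0:ℝ) < ((⌊T⌋₊ + 1 : ℕ) : ℝ) := by positivity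
    rw [div_mul_div_cancel₀ hpos.ne']
    gcongr
    · exact Lap_pos hX hp _
    · apply Lap_anti hX hp
      rw [Real.toNNReal_le_iff_le_coe]
      push_cast
      exact (Nat.lt_floor_add_one T).le
  · filter_upwards [eventually_ge_atTop 1] with T hT
    have hpos : (0:ℝ) < (⌊T⌋₊ : ℝ) := by exact_mod_cast Nat.floor_pos.2 hT
    rw [div_mul_div_cancel₀ hpos.ne']
    gcongr
    · exact Lap_pos hX hp _
    · apply Lap_anti hX hp
      rw [Real.le_toNNReal_iff_coe_le (by linarith)]
      exact_mod_cast Nat.floor_le (by linarith)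

lemma Lap_final (hX : IsBM X P) (hp : 2 < p) :
    ∃ K : ℝ, 0 < K ∧ Tendsto (fun x : ℝ => x ^ (2 / (p - 2)) *
      Real.log (P.real {ω | (pv p (fun t => X t ω) 1).toReal ≤ x})) (𝓝[>] 0) (𝓝 (-K)) := by
  obtain ⟨C, hC, hlim⟩ := Lap_fekete hX hp
  have h1 := Lap_real hX hp hlim
  have h2 : Tendsto (fun l : ℝ => l ^ (2/p)) atTop atTop := tendsto_rpow_atTop (by positivity)
  have h3 := h1.comp h2
  have h4 : Tendsto (fun l : ℝ => Real.log (∫ ω, Real.exp (-(l * (pv p (fun t => X t ω) 1).toReal)) ∂P) / l ^ (2/p))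
      atTop (𝓝 (-C)) := by
    refine h3.congr' ?_
    filter_upwards [eventually_gt_atTop 0] with l hl
    simp only [Function.comp_apply]
    have hl2 : 0 < l ^ (2/p) := by positivity
    rw [Lap_scale hX hp (by simpa using hl2), Real.coe_toNNReal _ hl2.le, ← Real.rpow_mul hl.le,
      show 2/p*(p/2) = 1 by field_simp, Real.rpow_one]
  obtain ⟨K, hK, h5⟩ := tauber (P := P) (hX.measurable_pv (p := p) (by linarith) 1).ennreal_toReal
    (fun ω => ENNReal.toReal_nonneg) (a := 2/p) (by positivity) (by rw [div_lt_one] <;> linarith) hC h4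
  refine ⟨K, hK, ?_⟩
  have : 2 / p / (1 - 2 / p) = 2 / (p - 2) := by
    have : p - 2 ≠ 0 := by linarith
    have : 1 - 2 / p ≠ 0 := by
      have : 2 / p < 1 := by rw [div_lt_one] <;> linarith
      linarith
    field_simp
  rwa [this] at h5

end

/-- Existence of a finite positive small deviation constant for Brownian motion under the
strong `p`-variation semi-norm (`p > 2`):
`lim_{ε↓0} ε^{2p/(p-2)} log P[V_p(B;[0,1]) ≤ ε] = -K` with `K ∈ (0,∞)`. -/
theorem small_deviation_BM_pvariation {Ω : Type*} [MeasurableSpace Ω]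
    (P : Measure Ω) [IsProbabilityMeasure P]
    (B : ℝ → Ω → ℝ)
    (hmeas : ∀ t : ℝ, Measurable (B t))
    (hgauss : ∀ (n : ℕ) (t c : Fin n → ℝ), (∀ i, 0 ≤ t i) →
      ∃ v : ℝ≥0, P.map (fun ω => ∑ i, c i * B (t i) ω) = gaussianReal 0 v)
    (hzero : ∀ ω, B 0 ω = 0)
    (hcov : ∀ s t : ℝ, 0 ≤ s → 0 ≤ t → ∫ ω, B s ω * B t ω ∂P = min s t)
    (hcont : ∀ ω, Continuous fun t => B t ω)
    (p : ℝ) (hp : 2 < p) :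
    ∃ K : ℝ, 0 < K ∧
      Tendsto
        (fun ε : ℝ =>
          ε ^ (2 * p / (p - 2)) *
            Real.log
              (P {ω | pVar p (fun t => B t ω) (Set.Icc 0 1) ≤ ENNReal.ofReal ε}).toReal)
        (𝓝[>] (0:ℝ)) (𝓝 (-K)) := by
  have hp0 : 0 < p := by linarith
  have hX : IsBM (fun (t : ℝ≥0) ω => B t ω) P :=
    ⟨preBrownian_of_hyp B hmeas hgauss hcov, fun t => hmeas t,
      fun ω => (hcont ω).comp NNReal.continuous_coe⟩
  obtain ⟨K, hK, h⟩ := Lap_final hX hp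
  refine ⟨K, hK, ?_⟩
  have hpow : Tendsto (fun ε : ℝ => ε ^ p) (𝓝[>] 0) (𝓝[>] 0) := by
    refine tendsto_nhdsWithin_iff.2 ⟨?_, ?_⟩
    · have := (Real.continuousAt_rpow_const 0 p (Or.inr hp0.le)).tendsto
      rw [Real.zero_rpow hp0.ne'] at this
      exact this.mono_left nhdsWithin_le_nhds
    · filter_upwards [self_mem_nhdsWithin] with ε (hε : 0 < ε)
      exact Real.rpow_pos_of_pos hε p
  refine (h.comp hpow).congr' ?_
  filter_upwards [self_mem_nhdsWithin] with ε (hε : 0 < ε)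
  simp only [Function.comp_apply]
  congr 1
  · rw [← Real.rpow_mul hε.le]
    congr 1
    ring
  · congr 1
    change (P _).toReal = _
    congr 1
    refine measure_congr ?_
    filter_upwards [hX.finite hp 1] with ω hω
    refine propext ?_
    change (_ ≤ _) ↔ (_ ≤ _)
    rw [pVar_le_iff hp0, ENNReal.ofReal_rpow_of_nonneg hε.le hp0.le,
      ENNReal.le_ofReal_iff_toReal_le hω.ne (by positivity)]
end
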